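/- arXiv:2109.01478 — 6 statements merged into one kernel-verified Lean document; each statement's English description precedes it below -/
import Mathlib

section
/- Suppose assumptions (A1)–(A5) hold. Given an initial condition x_0 ∈ ℝ and a price process ϖ ∈ H_𝔽, there exists an optimal control v* ∈ H_𝔽 minimizing I over H_𝔽, i.e. I[v*] ≤ I[v] for all v ∈ H_𝔽. -/
/- STATEMENT 3: Existence of an optimal control v* ∈ H_𝔽 minimizing I
   under assumptions (A1)-(A5). -/

open MeasureTheory

noncomputable section

/-- Membership in the space `H_𝔽`: progressively measurable processes with
`E[∫_0^T v_t² dt] < ∞`. -/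
def MemH {Ω : Type*} {m : MeasurableSpace Ω} (P : Measure Ω) (T : ℝ)
    (𝔽 : Filtration ℝ m) (v : ℝ → Ω → ℝ) : Prop :=
  ProgMeasurable 𝔽 v ∧
    (∫⁻ ω, (∫⁻ t in Set.Ioc (0:ℝ) T, ENNReal.ofReal ((v t ω) ^ 2)) ∂P) < ⊤

/-- Trajectory `X_t = x₀ + ∫_0^t v_s ds`. -/
def traj {Ω : Type*} (x0 : ℝ) (v : ℝ → Ω → ℝ) (t : ℝ) (ω : Ω) : ℝ :=
  x0 + ∫ s in (0:ℝ)..t, v s ω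

/-- Cost functional `I[v] = E[∫_0^T (L(X_t,v_t) + ϖ_t v_t) dt + Ψ(X_T)]`. -/
def cost {Ω : Type*} {_m : MeasurableSpace Ω} (P : Measure Ω) (T : ℝ)
    (L : ℝ → ℝ → ℝ) (Ψ : ℝ → ℝ) (ϖ : ℝ → Ω → ℝ) (x0 : ℝ) (v : ℝ → Ω → ℝ) : ℝ :=
  ∫ ω, ((∫ t in Set.Ioc (0:ℝ) T,
      (L (traj x0 v t ω) (v t ω) + ϖ t ω * v t ω)) + Ψ (traj x0 v T ω)) ∂P

open Filter Topology

theorem abstract_min {E : Type*} [NormedAddCommGroup E] [InnerProductSpace ℝ E] [CompleteSpace E]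
    (S : Set E) (hSne : S.Nonempty) (hSc : IsClosed S) (J : E → ℝ)
    (hJ : ConvexOn ℝ S J)
    (hlow : ∀ v ∈ S, ∃ A : ℝ, ∀ w ∈ S, J v ≤ J w + A * ‖w - v‖)
    (a K : ℝ) (ha : 0 < a) (hco : ∀ v ∈ S, a * ‖v‖ ^ 2 - K ≤ J v) :
    ∃ v ∈ S, ∀ w ∈ S, J v ≤ J w := by
  have hbdd : BddBelow (J '' S) := by
    refine ⟨-K, ?_⟩
    rintro _ ⟨v, hv, rfl⟩
    have := hco v hv
    nlinarith [sq_nonneg ‖v‖]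
  have hne : (J '' S).Nonempty := hSne.image J
  set I := sInf (J '' S) with hI
  have hIle : ∀ w ∈ S, I ≤ J w := fun w hw => csInf_le hbdd ⟨w, hw, rfl⟩
  let D : ℕ → Set E := fun n => {x ∈ S | J x ≤ I + 1 / ((n : ℝ) + 1)}
  have hDne : ∀ n, (D n).Nonempty := by
    intro n
    have hlt : sInf (J '' S) < I + 1 / ((n : ℝ) + 1) := by
      have : 0 < 1 / ((n : ℝ) + 1) := by positivity
      linarith
    obtain ⟨_, ⟨v, hv, rfl⟩, h⟩ := exists_lt_of_csInf_lt hne hlt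
    exact ⟨v, hv, h.le⟩
  have hDconv : ∀ n, Convex ℝ (D n) := fun n => hJ.convex_le _
  have hDclosed : ∀ n, IsClosed (D n) := by
    intro n
    apply IsSeqClosed.isClosed
    intro u x hu hx
    have hxS : x ∈ S := hSc.isSeqClosed (fun k => (hu k).1) hx
    refine ⟨hxS, ?_⟩
    obtain ⟨A, hA⟩ := hlow x hxS
    have h1 : Tendsto (fun k => (I + 1 / ((n : ℝ) + 1)) + A * ‖u k - x‖) atTop
        (𝓝 ((I + 1 / ((n : ℝ) + 1)) + A * 0)) := by
      refine tendsto_const_nhds.add (tendsto_const_nhds.mul ?_)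
      exact tendsto_iff_norm_sub_tendsto_zero.1 hx
    rw [mul_zero, add_zero] at h1
    refine ge_of_tendsto' h1 fun k => ?_
    have := hA (u k) (hu k).1
    have := (hu k).2
    linarith
  have hDanti : ∀ i j, i ≤ j → D j ⊆ D i := by
    intro i j hij x hx
    refine ⟨hx.1, hx.2.trans ?_⟩
    have : 1 / ((j : ℝ) + 1) ≤ 1 / ((i : ℝ) + 1) := by
      apply one_div_le_one_div_of_le (by positivity)
      have : (i : ℝ) ≤ j := by exact_mod_cast hij
      linarith
    linarith
  have hp : ∀ n, ∃ p ∈ D n, ∀ w ∈ D n, ‖p‖ ^ 2 ≤ inner ℝ p w := by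
    intro n
    obtain ⟨p, hpD, hpn⟩ := exists_norm_eq_iInf_of_complete_convex (hDne n)
      (hDclosed n).isComplete (hDconv n) 0
    refine ⟨p, hpD, fun w hw => ?_⟩
    have := (norm_eq_iInf_iff_real_inner_le_zero (hDconv n) hpD).1 hpn w hw
    rw [zero_sub, inner_neg_left, inner_sub_right, real_inner_self_eq_norm_sq] at this
    linarith
  choose p hpD hpi using hp
  have hkey : ∀ i j, i ≤ j → ‖p j - p i‖ ^ 2 ≤ ‖p j‖ ^ 2 - ‖p i‖ ^ 2 := by
    intro i j hij
    have h1 := hpi i (p j) (hDanti i j hij (hpD j))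
    rw [norm_sub_sq_real, real_inner_comm]
    linarith
  have hmono : Monotone fun n => ‖p n‖ ^ 2 := by
    intro i j hij
    have := hkey i j hij
    have h2 := sq_nonneg ‖p j - p i‖
    show ‖p i‖ ^ 2 ≤ ‖p j‖ ^ 2
    linarith
  have hbd : BddAbove (Set.range fun n => ‖p n‖ ^ 2) := by
    refine ⟨(I + 1 + K) / a, ?_⟩
    rintro _ ⟨n, rfl⟩
    have h1 := hco _ (hDanti 0 n (Nat.zero_le _) (hpD n)).1
    have h2 := (hDanti 0 n (Nat.zero_le _) (hpD n)).2
    simp at h2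
    show ‖p n‖ ^ 2 ≤ _
    rw [le_div_iff₀ ha]
    nlinarith
  have hcs := (tendsto_atTop_ciSup hmono hbd).cauchySeq
  have hcp : CauchySeq p := by
    rw [Metric.cauchySeq_iff'] at hcs ⊢
    intro ε hε
    obtain ⟨N, hN⟩ := hcs (ε ^ 2) (by positivity)
    refine ⟨N, fun n hn => ?_⟩
    have h1 := hN n hn
    have h2 := hkey N n hn
    rw [Real.dist_eq] at h1
    rw [dist_eq_norm]
    have h3 := (le_abs_self _).trans_lt h1
    exact lt_of_pow_lt_pow_left₀ 2 hε.le (h2.trans_lt h3)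
  obtain ⟨x, hx⟩ := cauchySeq_tendsto_of_complete hcp
  have hxD : ∀ n, x ∈ D n := by
    intro n
    refine (hDclosed n).mem_of_tendsto hx ?_
    filter_upwards [eventually_ge_atTop n] with k hk
    exact hDanti n k hk (hpD k)
  refine ⟨x, (hxD 0).1, fun w hw => ?_⟩
  refine le_trans ?_ (hIle w hw)
  have h1 : Tendsto (fun n : ℕ => I + 1 / ((n : ℝ) + 1)) atTop (𝓝 (I + 0)) :=
    tendsto_const_nhds.add tendsto_one_div_add_atTop_nhds_zero_nat
  rw [add_zero] at h1
  exact ge_of_tendsto' h1 fun n => (hxD n).2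

theorem psi_lower (Ψ : ℝ → ℝ) (h1 : ContDiff ℝ 1 Ψ) (hc : ConvexOn ℝ Set.univ Ψ) (x y : ℝ) :
    Ψ x + deriv Ψ x * (y - x) ≤ Ψ y := by
  have hd : HasDerivAt Ψ (deriv Ψ x) x := (h1.differentiable (by simp) x).hasDerivAt
  rcases lt_trichotomy x y with h | h | h
  · have := hc.le_slope_of_hasDerivAt (Set.mem_univ _) (Set.mem_univ _) h hd
    rw [slope_def_field, le_div_iff₀ (by linarith)] at this
    linarith
  · subst h; simp
  · have := hc.slope_le_of_hasDerivAt (Set.mem_univ _) (Set.mem_univ _) h hd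
    rw [slope_def_field, div_le_iff₀ (by linarith)] at this
    linarith

theorem L_lower (L : ℝ → ℝ → ℝ) (hL : ContDiff ℝ 1 (Function.uncurry L))
    (hc : ConvexOn ℝ Set.univ (Function.uncurry L)) (x v y w : ℝ) :
    L x v + deriv (fun y => L y v) x * (y - x) + deriv (fun w => L x w) v * (w - v) ≤ L y w := by
  have hF : HasFDerivAt (Function.uncurry L) (fderiv ℝ (Function.uncurry L) (x, v)) (x, v) :=
    (hL.differentiable (by simp) (x, v)).hasFDerivAt
  set F := fderiv ℝ (Function.uncurry L) (x, v)
  have hx : HasDerivAt (fun y => L y v) (F (1, 0)) x := by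
    have := hF.comp_hasDerivAt x ((hasDerivAt_id x).prodMk (hasDerivAt_const x v))
    exact this
  have hv : HasDerivAt (fun w => L x w) (F (0, 1)) v := by
    have := hF.comp_hasDerivAt v ((hasDerivAt_const v x).prodMk (hasDerivAt_id v))
    exact this
  rw [hx.deriv, hv.deriv]
  let g : ℝ → ℝ := fun s => L (x + s * (y - x)) (v + s * (w - v))
  have hg1 : ContDiff ℝ 1 g :=
    hL.comp (f := fun s : ℝ => (x + s * (y - x), v + s * (w - v))) (by fun_prop)
  have hgc : ConvexOn ℝ Set.univ g := by
    refine ⟨convex_univ, fun s _ t _ a b ha hb hab => ?_⟩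
    have := hc.2 (Set.mem_univ (x + s * (y - x), v + s * (w - v)))
      (Set.mem_univ (x + t * (y - x), v + t * (w - v))) ha hb hab
    refine le_trans (le_of_eq ?_) this
    simp only [g, Function.uncurry, smul_eq_mul, Prod.smul_fst, Prod.smul_snd, Prod.fst_add,
      Prod.snd_add]
    have hb' : b = 1 - a := by linarith
    subst hb'
    all_goals first | rfl | (congr 1 <;> ring)
  have hgd : HasDerivAt g (F (y - x, w - v)) 0 := by
    have h0 : HasDerivAt (fun s : ℝ => (x + s * (y - x), v + s * (w - v))) (y - x, w - v) 0 := by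
      have h1 : HasDerivAt (fun s : ℝ => x + s * (y - x)) (y - x) 0 := by
        simpa using ((hasDerivAt_id (0:ℝ)).mul_const (y - x)).const_add x
      have h2 : HasDerivAt (fun s : ℝ => v + s * (w - v)) (w - v) 0 := by
        simpa using ((hasDerivAt_id (0:ℝ)).mul_const (w - v)).const_add v
      exact h1.prodMk h2
    have hF' : HasFDerivAt (Function.uncurry L) F
        ((fun s : ℝ => (x + s * (y - x), v + s * (w - v))) 0) := by simpa using hF
    exact hF'.comp_hasDerivAt 0 h0
  have := psi_lower g hg1 hgc 0 1
  rw [hgd.deriv] at this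
  have hlin : F (y - x, w - v) = F (1, 0) * (y - x) + F (0, 1) * (w - v) := by
    have : ((y - x, w - v) : ℝ × ℝ) = (y - x) • (1, 0) + (w - v) • (0, 1) := by simp
    rw [this, map_add, map_smul, map_smul]
    simp [mul_comm]
  simp only [g] at this
  rw [hlin] at this
  simp at this
  linarith

theorem cs_ineq {X : Type*} {mX : MeasurableSpace X} {μ : Measure X} {f g : X → ℝ}
    (hf : MemLp f 2 μ) (hg : MemLp g 2 μ) :
    ∫ x, |f x| * |g x| ∂μ ≤ √(∫ x, f x ^ 2 ∂μ) * √(∫ x, g x ^ 2 ∂μ) := by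
  have := integral_mul_le_Lp_mul_Lq_of_nonneg (μ := μ) (p := 2) (q := 2)
    Real.HolderConjugate.two_two (f := fun x => |f x|) (g := fun x => |g x|)
    (ae_of_all _ fun x => abs_nonneg _) (ae_of_all _ fun x => abs_nonneg _)
    (by rw [ENNReal.ofReal_ofNat]; exact hf.abs) (by rw [ENNReal.ofReal_ofNat]; exact hg.abs)
  simpa [Real.sqrt_eq_rpow] using this

/-- Product measure on time times probability space. -/
abbrev muT {Ω : Type*} {m : MeasurableSpace Ω} (P : Measure Ω) (T : ℝ) : Measure (ℝ × Ω) :=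
  (volume.restrict (Set.Ioc (0:ℝ) T)).prod P

/-- Jointly measurable square-integrable processes. -/
def Good {Ω : Type*} {m : MeasurableSpace Ω} (P : Measure Ω) (T : ℝ) (v : ℝ → Ω → ℝ) : Prop :=
  StronglyMeasurable (Function.uncurry v) ∧ MemLp (Function.uncurry v) 2 (muT P T)

/-- Pathwise L1 norm. -/
def NN {Ω : Type*} (T : ℝ) (v : ℝ → Ω → ℝ) (ω : Ω) : ℝ :=
  ∫ t in Set.Ioc (0:ℝ) T, |v t ω|

/-- Squared L2 norm. -/
def Q {Ω : Type*} {m : MeasurableSpace Ω} (P : Measure Ω) (T : ℝ) (v : ℝ → Ω → ℝ) : ℝ :=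
  ∫ p, (v p.1 p.2) ^ 2 ∂(muT P T)

section
set_option linter.unusedSectionVars false
variable {Ω : Type*} {m : MeasurableSpace Ω} {P : Measure Ω} [IsProbabilityMeasure P] {T : ℝ}
  {v w : ℝ → Ω → ℝ}

theorem Good.comb (hv : Good P T v) (hw : Good P T w) (a b : ℝ) :
    Good P T (fun t ω => a * v t ω + b * w t ω) :=
  ⟨(hv.1.const_mul a).add (hw.1.const_mul b), (hv.2.const_mul a).add (hw.2.const_mul b)⟩

theorem Good.sub (hv : Good P T v) (hw : Good P T w) :
    Good P T (fun t ω => v t ω - w t ω) :=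
  ⟨hv.1.sub hw.1, hv.2.sub hw.2⟩

theorem Good.sq (hv : Good P T v) :
    Integrable (fun p : ℝ × Ω => (v p.1 p.2) ^ 2) (muT P T) := hv.2.integrable_sq

theorem Good.slice (hv : Good P T v) (ω : Ω) : StronglyMeasurable (fun t => v t ω) :=
  hv.1.comp_measurable (measurable_id.prodMk measurable_const)

theorem Good.ae (hv : Good P T v) :
    ∀ᵐ ω ∂P, MemLp (fun t => v t ω) 2 (volume.restrict (Set.Ioc (0:ℝ) T)) := by
  filter_upwards [hv.sq.prod_left_ae] with ω h
  exact (memLp_two_iff_integrable_sq (hv.slice ω).aestronglyMeasurable).2 h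

theorem Good.ae_int (hv : Good P T v) :
    ∀ᵐ ω ∂P, IntegrableOn (fun t => v t ω) (Set.Ioc (0:ℝ) T) := by
  filter_upwards [hv.ae] with ω h
  exact h.integrable (by norm_num)

theorem traj_sm (x0 : ℝ) (hv : StronglyMeasurable (Function.uncurry v)) :
    StronglyMeasurable (fun p : ℝ × Ω => traj x0 v p.1 p.2) := by
  have key : ∀ A : Set ((ℝ × Ω) × ℝ), MeasurableSet A →
      StronglyMeasurable (fun p : ℝ × Ω => ∫ s, A.indicator (fun q => v q.2 q.1.2) (p, s)) := by
    intro A hA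
    apply StronglyMeasurable.integral_prod_right'
      (f := fun z => A.indicator (fun q => v q.2 q.1.2) z)
    refine StronglyMeasurable.indicator ?_ hA
    exact hv.comp_measurable (g := fun q : (ℝ × Ω) × ℝ => (q.2, q.1.2)) (by fun_prop)
  have e : (fun p : ℝ × Ω => traj x0 v p.1 p.2) = fun p : ℝ × Ω =>
      x0 + ((∫ s, ({q : (ℝ × Ω) × ℝ | 0 < q.2 ∧ q.2 ≤ q.1.1}).indicator
        (fun q => v q.2 q.1.2) (p, s)) -
      ∫ s, ({q : (ℝ × Ω) × ℝ | q.1.1 < q.2 ∧ q.2 ≤ 0}).indicator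
        (fun q => v q.2 q.1.2) (p, s)) := by
    funext p
    unfold traj intervalIntegral
    rw [← integral_indicator measurableSet_Ioc, ← integral_indicator measurableSet_Ioc]
    rfl
  rw [e]
  refine stronglyMeasurable_const.add ((key _ ?_).sub (key _ ?_))
  · exact (measurableSet_lt measurable_const measurable_snd).inter
      (measurableSet_le measurable_snd (measurable_fst.comp measurable_fst))
  · exact (measurableSet_lt (measurable_fst.comp measurable_fst) measurable_snd).inter
      (measurableSet_le measurable_snd measurable_const)

theorem NN_nonneg (ω : Ω) : 0 ≤ NN T v ω := integral_nonneg fun _ => abs_nonneg _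

theorem NN_sm (hv : Good P T v) : StronglyMeasurable (NN T v) := by
  have : StronglyMeasurable (fun p : Ω × ℝ => |v p.2 p.1|) := by
    have := hv.1.comp_measurable (measurable_swap (α := Ω) (β := ℝ))
    exact this.norm
  exact this.integral_prod_right'

theorem NN_sq_le (hT : 0 < T) (hv : Good P T v) :
    ∀ᵐ ω ∂P, NN T v ω ^ 2 ≤ T * ∫ t in Set.Ioc (0:ℝ) T, v t ω ^ 2 := by
  filter_upwards [hv.ae] with ω h
  have h1 := cs_ineq h (memLp_const (1:ℝ))
  simp only [abs_one, mul_one, one_pow] at h1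
  have h2 : ∫ _x in Set.Ioc (0:ℝ) T, (1:ℝ) = T := by simp [hT.le]
  rw [h2] at h1
  have h3 : (0:ℝ) ≤ ∫ t in Set.Ioc (0:ℝ) T, v t ω ^ 2 := integral_nonneg fun _ => sq_nonneg _
  calc NN T v ω ^ 2 ≤ (√(∫ t in Set.Ioc (0:ℝ) T, v t ω ^ 2) * √T) ^ 2 :=
        pow_le_pow_left₀ (NN_nonneg ω) h1 2
    _ = _ := by rw [mul_pow, Real.sq_sqrt h3, Real.sq_sqrt hT.le, mul_comm]

theorem NN_memLp (hT : 0 < T) (hv : Good P T v) : MemLp (NN T v) 2 P := by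
  rw [memLp_two_iff_integrable_sq (NN_sm hv).aestronglyMeasurable]
  refine Integrable.mono' (hv.sq.integral_prod_right.const_mul T)
    ((NN_sm hv).pow 2).aestronglyMeasurable ?_
  filter_upwards [NN_sq_le hT hv] with ω h
  rw [Real.norm_eq_abs, abs_of_nonneg (sq_nonneg _)]
  exact h

theorem NN_Q (hT : 0 < T) (hv : Good P T v) : ∫ ω, NN T v ω ^ 2 ∂P ≤ T * Q P T v := by
  unfold Q
  rw [integral_prod_symm _ hv.sq, ← integral_const_mul]
  exact integral_mono_ae (NN_memLp hT hv).integrable_sq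
    (hv.sq.integral_prod_right.const_mul T) (NN_sq_le hT hv)

theorem NN_memLp' (hT : 0 < T) (hv : Good P T v) :
    MemLp (fun p : ℝ × Ω => NN T v p.2) 2 (muT P T) := by
  exact (NN_memLp hT hv).comp_snd _

theorem NN_Q' (hT : 0 < T) (hv : Good P T v) :
    ∫ p : ℝ × Ω, NN T v p.2 ^ 2 ∂(muT P T) ≤ T * (T * Q P T v) := by
  rw [integral_fun_snd (μ := volume.restrict (Set.Ioc (0:ℝ) T)) (fun ω => NN T v ω ^ 2)]
  simp only [measureReal_restrict_apply_univ, Real.volume_real_Ioc, smul_eq_mul, sub_zero,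
    max_eq_left hT.le]
  exact mul_le_mul_of_nonneg_left (NN_Q hT hv) hT.le

theorem traj_sub_le (x0 : ℝ) {t : ℝ} (ht : t ∈ Set.Icc 0 T) {ω : Ω}
    (hv : IntegrableOn (fun t => v t ω) (Set.Ioc (0:ℝ) T)) : |traj x0 v t ω - x0| ≤ NN T v ω := by
  unfold traj NN
  rw [add_sub_cancel_left, intervalIntegral.integral_of_le ht.1]
  calc |∫ s in Set.Ioc 0 t, v s ω| ≤ ∫ s in Set.Ioc 0 t, |v s ω| := abs_integral_le_integral_abs
    _ ≤ _ := setIntegral_mono_set hv.abs (ae_of_all _ fun _ => abs_nonneg _)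
      (Set.Ioc_subset_Ioc_right ht.2).eventuallyLE

theorem traj_comb (x0 a b : ℝ) (hab : a + b = 1) {t : ℝ} (ht : t ∈ Set.Icc 0 T) {ω : Ω}
    (hv : IntegrableOn (fun t => v t ω) (Set.Ioc (0:ℝ) T))
    (hw : IntegrableOn (fun t => w t ω) (Set.Ioc (0:ℝ) T)) :
    traj x0 (fun t ω => a * v t ω + b * w t ω) t ω = a * traj x0 v t ω + b * traj x0 w t ω := by
  have hi : ∀ u : ℝ → Ω → ℝ, IntegrableOn (fun t => u t ω) (Set.Ioc (0:ℝ) T) →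
      IntervalIntegrable (fun t => u t ω) volume 0 t := fun u hu => by
    rw [intervalIntegrable_iff_integrableOn_Ioc_of_le ht.1]
    exact hu.mono_set (Set.Ioc_subset_Ioc_right ht.2)
  unfold traj
  rw [intervalIntegral.integral_add ((hi v hv).const_mul a) ((hi w hw).const_mul b),
    intervalIntegral.integral_const_mul, intervalIntegral.integral_const_mul]
  linear_combination x0 * (-hab)

theorem traj_diff (x0 : ℝ) {t : ℝ} (ht : t ∈ Set.Icc 0 T) {ω : Ω}
    (hv : IntegrableOn (fun t => v t ω) (Set.Ioc (0:ℝ) T))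
    (hw : IntegrableOn (fun t => w t ω) (Set.Ioc (0:ℝ) T)) :
    |traj x0 w t ω - traj x0 v t ω| ≤ NN T (fun t ω => w t ω - v t ω) ω := by
  have hi : ∀ u : ℝ → Ω → ℝ, IntegrableOn (fun t => u t ω) (Set.Ioc (0:ℝ) T) →
      IntervalIntegrable (fun t => u t ω) volume 0 t := fun u hu => by
    rw [intervalIntegrable_iff_integrableOn_Ioc_of_le ht.1]
    exact hu.mono_set (Set.Ioc_subset_Ioc_right ht.2)
  have h := traj_sub_le x0 ht (v := fun t ω => w t ω - v t ω) (ω := ω) (hw.sub hv)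
  refine le_trans (le_of_eq ?_) h
  unfold traj
  rw [intervalIntegral.integral_sub (hi w hw) (hi v hv)]
  congr 1; ring

theorem ae_mu_of_ae {p : Ω → Prop} (h : ∀ᵐ ω ∂P, p ω) :
    ∀ᵐ q ∂(muT P T), q.1 ∈ Set.Ioc 0 T ∧ p q.2 := by
  have h1 : ∀ᵐ q ∂(muT P T), p q.2 := Measure.quasiMeasurePreserving_snd.ae h
  have h2 : ∀ᵐ q ∂(muT P T), q.1 ∈ Set.Ioc 0 T :=
    Measure.quasiMeasurePreserving_fst.ae (ae_restrict_mem measurableSet_Ioc)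
  filter_upwards [h1, h2] with q a b using ⟨b, a⟩

end

section
set_option linter.unusedSectionVars false
variable {Ω : Type*} {m : MeasurableSpace Ω} {P : Measure Ω} [IsProbabilityMeasure P] {T : ℝ}
  {v w : ℝ → Ω → ℝ} {L : ℝ → ℝ → ℝ} {Ψ : ℝ → ℝ} {ϖ : ℝ → Ω → ℝ} {x0 : ℝ}

theorem G1_int (hLc : Continuous (Function.uncurry L)) (hL_nonneg : ∀ x v, 0 ≤ L x v)
    (hL_growth : ∃ β > (0:ℝ), ∀ x v, L x v ≤ β * (1 + |v| ^ 2)) (hv : Good P T v) :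
    Integrable (fun p : ℝ × Ω => L (traj x0 v p.1 p.2) (v p.1 p.2)) (muT P T) := by
  obtain ⟨b, hb, h⟩ := hL_growth
  refine Integrable.mono' (((integrable_const (1:ℝ)).add hv.sq).const_mul b)
    (hLc.comp_stronglyMeasurable ((traj_sm x0 hv.1).prodMk hv.1)).aestronglyMeasurable ?_
  refine ae_of_all _ fun p => ?_
  rw [Real.norm_eq_abs, abs_of_nonneg (hL_nonneg _ _)]
  simpa using h (traj x0 v p.1 p.2) (v p.1 p.2)

theorem G2_int (hϖ : Good P T ϖ) (hv : Good P T v) :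
    Integrable (fun p : ℝ × Ω => ϖ p.1 p.2 * v p.1 p.2) (muT P T) :=
  hϖ.2.integrable_mul hv.2

theorem Psi_int (hT : 0 < T) (hΨc : Continuous Ψ) (hΨ_nonneg : ∀ x, 0 ≤ Ψ x)
    (hΨ_growth : ∃ C > (0:ℝ), ∀ x, Ψ x ≤ C * (1 + |x| ^ 2)) (hv : Good P T v) :
    Integrable (fun ω => Ψ (traj x0 v T ω)) P := by
  obtain ⟨b, hb, h⟩ := hΨ_growth
  have hs : StronglyMeasurable (fun ω => traj x0 v T ω) :=
    (traj_sm x0 hv.1).comp_measurable (measurable_const.prodMk measurable_id)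
  refine Integrable.mono' (g := fun ω => b * (1 + (2 * x0 ^ 2 + 2 * NN T v ω ^ 2)))
    (((integrable_const _).add ((integrable_const _).add
      ((NN_memLp hT hv).integrable_sq.const_mul 2))).const_mul b)
    (hΨc.comp_stronglyMeasurable hs).aestronglyMeasurable ?_
  filter_upwards [hv.ae_int] with ω hω
  rw [Real.norm_eq_abs, abs_of_nonneg (hΨ_nonneg _)]
  refine (h _).trans ?_
  have h1 := traj_sub_le x0 (Set.right_mem_Icc.2 hT.le) hω
  rw [sq_abs]
  have h2 : (traj x0 v T ω - x0) ^ 2 ≤ NN T v ω ^ 2 := sq_le_sq' (by linarith [(abs_le.1 h1).1]) (abs_le.1 h1).2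
  refine mul_le_mul_of_nonneg_left ?_ hb.le
  nlinarith [sq_nonneg (traj x0 v T ω - 2 * x0)]

theorem cost_eq (hT : 0 < T) (hLc : Continuous (Function.uncurry L)) (hL_nonneg : ∀ x v, 0 ≤ L x v)
    (hL_growth : ∃ β > (0:ℝ), ∀ x v, L x v ≤ β * (1 + |v| ^ 2))
    (hΨc : Continuous Ψ) (hΨ_nonneg : ∀ x, 0 ≤ Ψ x)
    (hΨ_growth : ∃ C > (0:ℝ), ∀ x, Ψ x ≤ C * (1 + |x| ^ 2)) (hϖ : Good P T ϖ)
    (hv : Good P T v) :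
    cost P T L Ψ ϖ x0 v = ∫ p, (L (traj x0 v p.1 p.2) (v p.1 p.2) + ϖ p.1 p.2 * v p.1 p.2) ∂(muT P T)
      + ∫ ω, Ψ (traj x0 v T ω) ∂P := by
  have hG := (G1_int (x0 := x0) hLc hL_nonneg hL_growth hv).add (G2_int hϖ hv)
  have e := integral_prod_symm _ hG
  simp only [Pi.add_apply] at e
  rw [e]
  unfold cost
  exact integral_add hG.integral_prod_right (Psi_int hT hΨc hΨ_nonneg hΨ_growth hv)

theorem cost_convex (hT : 0 < T) (hLc : Continuous (Function.uncurry L)) (hL_nonneg : ∀ x v, 0 ≤ L x v)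
    (hL_growth : ∃ β > (0:ℝ), ∀ x v, L x v ≤ β * (1 + |v| ^ 2))
    (hΨc : Continuous Ψ) (hΨ_nonneg : ∀ x, 0 ≤ Ψ x)
    (hΨ_growth : ∃ C > (0:ℝ), ∀ x, Ψ x ≤ C * (1 + |x| ^ 2)) (hϖ : Good P T ϖ)
    (hL_convex : ConvexOn ℝ Set.univ (Function.uncurry L))
    (hΨ_convex : ConvexOn ℝ Set.univ Ψ)
    (hv : Good P T v) (hw : Good P T w) (a b : ℝ) (ha : 0 ≤ a) (hb : 0 ≤ b) (hab : a + b = 1) :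
    cost P T L Ψ ϖ x0 (fun t ω => a * v t ω + b * w t ω) ≤
      a * cost P T L Ψ ϖ x0 v + b * cost P T L Ψ ϖ x0 w := by
  have hc := hv.comb hw a b
  rw [cost_eq hT hLc hL_nonneg hL_growth hΨc hΨ_nonneg hΨ_growth hϖ hv,
    cost_eq hT hLc hL_nonneg hL_growth hΨc hΨ_nonneg hΨ_growth hϖ hw,
    cost_eq hT hLc hL_nonneg hL_growth hΨc hΨ_nonneg hΨ_growth hϖ hc]
  have hG := fun {v} (hv : Good P T v) =>
    (G1_int (x0 := x0) hLc hL_nonneg hL_growth hv).add (G2_int hϖ hv)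
  have hP := fun {v} (hv : Good P T v) => Psi_int (x0 := x0) hT hΨc hΨ_nonneg hΨ_growth hv
  have h1 := integral_mono_ae (hG hc) (((hG hv).const_mul a).add ((hG hw).const_mul b)) (by
    filter_upwards [ae_mu_of_ae (T := T) (hv.ae_int.and hw.ae_int)] with p hp
    simp only [Pi.add_apply]
    rw [traj_comb x0 a b hab ⟨hp.1.1.le, hp.1.2⟩ hp.2.1 hp.2.2]
    have := hL_convex.2 (Set.mem_univ (traj x0 v p.1 p.2, v p.1 p.2))
      (Set.mem_univ (traj x0 w p.1 p.2, w p.1 p.2)) ha hb hab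
    simp only [Function.uncurry, smul_eq_mul, Prod.smul_fst, Prod.smul_snd, Prod.fst_add,
      Prod.snd_add] at this
    linarith)
  have h2 := integral_mono_ae (hP hc) (((hP hv).const_mul a).add ((hP hw).const_mul b)) (by
    filter_upwards [hv.ae_int, hw.ae_int] with ω hp hq
    simp only [Pi.add_apply]
    rw [traj_comb x0 a b hab ⟨hT.le, le_rfl⟩ hp hq]
    have := hΨ_convex.2 (Set.mem_univ (traj x0 v T ω)) (Set.mem_univ (traj x0 w T ω)) ha hb hab
    simpa using this)
  rw [integral_add' ((hG hv).const_mul a) ((hG hw).const_mul b), integral_const_mul,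
    integral_const_mul] at h1
  rw [integral_add' ((hP hv).const_mul a) ((hP hw).const_mul b), integral_const_mul,
    integral_const_mul] at h2
  simp only [Pi.add_apply] at h1
  linarith

theorem cost_coercive (hT : 0 < T) (hLc : Continuous (Function.uncurry L)) (hL_nonneg : ∀ x v, 0 ≤ L x v)
    (hL_growth : ∃ β > (0:ℝ), ∀ x v, L x v ≤ β * (1 + |v| ^ 2))
    (hΨc : Continuous Ψ) (hΨ_nonneg : ∀ x, 0 ≤ Ψ x)
    (hΨ_growth : ∃ C > (0:ℝ), ∀ x, Ψ x ≤ C * (1 + |x| ^ 2)) (hϖ : Good P T ϖ)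
    (α β : ℝ) (hα : 0 < α)
    (hL_coercive : ∀ x v, α * |v| ^ 2 - β ≤ L x v)
    (hv : Good P T v) :
    α / 2 * Q P T v - (β * T + 1 / (2 * α) * Q P T ϖ) ≤ cost P T L Ψ ϖ x0 v := by
  rw [cost_eq hT hLc hL_nonneg hL_growth hΨc hΨ_nonneg hΨ_growth hϖ hv]
  have hG := (G1_int (x0 := x0) hLc hL_nonneg hL_growth hv).add (G2_int hϖ hv)
  have h0 : 0 ≤ ∫ ω, Ψ (traj x0 v T ω) ∂P := integral_nonneg fun _ => hΨ_nonneg _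
  have hi1 : Integrable (fun _ : ℝ × Ω => β) (muT P T) := integrable_const β
  have hi2 := hϖ.sq.const_mul (1 / (2 * α))
  have hi3 := hv.sq.const_mul (α / 2)
  have h1 := integral_mono_ae (hi3.sub (hi1.add hi2)) hG (by
    refine ae_of_all _ fun p => ?_
    simp only [Pi.add_apply, Pi.sub_apply]
    have h := hL_coercive (traj x0 v p.1 p.2) (v p.1 p.2)
    rw [sq_abs] at h
    have h3 : 0 ≤ 1 / (2 * α) * (ϖ p.1 p.2 + α * v p.1 p.2) ^ 2 := by positivity
    have h4 : 1 / (2 * α) * (ϖ p.1 p.2 + α * v p.1 p.2) ^ 2 =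
      1 / (2 * α) * ϖ p.1 p.2 ^ 2 + ϖ p.1 p.2 * v p.1 p.2 + α / 2 * v p.1 p.2 ^ 2 := by
      field_simp
      ring
    linarith)
  rw [integral_sub' hi3 (hi1.add hi2), integral_add' hi1 hi2, integral_const_mul,
    integral_const_mul] at h1
  have h5 : ∫ _ : ℝ × Ω, β ∂(muT P T) = β * T := by
    rw [integral_const, measureReal_def, ← Set.univ_prod_univ, Measure.prod_prod]
    simp [hT.le, mul_comm]
  rw [h5] at h1
  simp only [Pi.add_apply] at h1
  unfold Q
  linarith

theorem cost_lower (hT : 0 < T) (hL_C1 : ContDiff ℝ 1 (Function.uncurry L))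
    (hL_nonneg : ∀ x v, 0 ≤ L x v)
    (hL_growth : ∃ β > (0:ℝ), ∀ x v, L x v ≤ β * (1 + |v| ^ 2))
    (hΨ_C1 : ContDiff ℝ 1 Ψ) (hΨ_nonneg : ∀ x, 0 ≤ Ψ x)
    (hΨ_growth : ∃ C > (0:ℝ), ∀ x, Ψ x ≤ C * (1 + |x| ^ 2)) (hϖ : Good P T ϖ)
    (hL_convex : ConvexOn ℝ Set.univ (Function.uncurry L))
    (hΨ_convex : ConvexOn ℝ Set.univ Ψ)
    (hΨ'_growth : ∃ C > (0:ℝ), ∀ x, |deriv Ψ x| ≤ C * (1 + |x|))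
    (hL_deriv_growth : ∃ C > (0:ℝ), ∀ x v,
      |deriv (fun y => L y v) x| ≤ C * (1 + |v|) ∧
      |deriv (fun w => L x w) v| ≤ C * (1 + |v|))
    (hv : Good P T v) : ∃ A : ℝ, ∀ w, Good P T w →
    cost P T L Ψ ϖ x0 v ≤ cost P T L Ψ ϖ x0 w + A * √(Q P T (fun t ω => w t ω - v t ω)) := by
  obtain ⟨C, hC, hLd⟩ := hL_deriv_growth
  obtain ⟨D, hD, hΨd⟩ := hΨ'_growth
  have hLc := hL_C1.continuous
  have hΨc := hΨ_C1.continuous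
  have hG := fun {v} (hv : Good P T v) =>
    (G1_int (x0 := x0) hLc hL_nonneg hL_growth hv).add (G2_int hϖ hv)
  have hP := fun {v} (hv : Good P T v) => Psi_int (x0 := x0) hT hΨc hΨ_nonneg hΨ_growth hv
  have hf1 : MemLp (fun p : ℝ × Ω => 1 + |v p.1 p.2|) 2 (muT P T) :=
    (memLp_const (1:ℝ)).add hv.2.abs
  have hf2 : MemLp (fun ω => 1 + (|x0| + NN T v ω)) 2 P :=
    (memLp_const (1:ℝ)).add ((memLp_const |x0|).add (NN_memLp hT hv))
  refine ⟨C * √(∫ p : ℝ × Ω, (1 + |v p.1 p.2|) ^ 2 ∂(muT P T)) * T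
    + C * √(∫ p : ℝ × Ω, (1 + |v p.1 p.2|) ^ 2 ∂(muT P T)) + √(Q P T ϖ)
    + D * √(∫ ω, (1 + (|x0| + NN T v ω)) ^ 2 ∂P) * √T, fun w hw => ?_⟩
  rw [cost_eq hT hLc hL_nonneg hL_growth hΨc hΨ_nonneg hΨ_growth hϖ hv,
    cost_eq hT hLc hL_nonneg hL_growth hΨc hΨ_nonneg hΨ_growth hϖ hw]
  have hd := hw.sub hv
  set d : ℝ → Ω → ℝ := fun t ω => w t ω - v t ω with hdd
  have hN := NN_memLp' hT hd
  have hN1 := NN_memLp hT hd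
  have hd2 : MemLp (fun p : ℝ × Ω => d p.1 p.2) 2 (muT P T) := hd.2
  have hϖ2 : MemLp (fun p : ℝ × Ω => ϖ p.1 p.2) 2 (muT P T) := hϖ.2
  have i1 : Integrable (fun p : ℝ × Ω => |(1 + |v p.1 p.2|)| * |NN T d p.2|) (muT P T) :=
    hf1.abs.integrable_mul hN.abs
  have i2 : Integrable (fun p : ℝ × Ω => |(1 + |v p.1 p.2|)| * |d p.1 p.2|) (muT P T) :=
    hf1.abs.integrable_mul hd2.abs
  have i3 : Integrable (fun p : ℝ × Ω => |ϖ p.1 p.2| * |d p.1 p.2|) (muT P T) :=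
    hϖ2.abs.integrable_mul hd2.abs
  have i4 : Integrable (fun ω => |1 + (|x0| + NN T v ω)| * |NN T d ω|) P :=
    hf2.abs.integrable_mul hN1.abs
  have h1 := integral_mono_ae (hG hv)
    ((hG hw).add (((i1.const_mul C).add (i2.const_mul C)).add i3)) (by
    filter_upwards [ae_mu_of_ae (T := T) (hv.ae_int.and hw.ae_int)] with p hp
    simp only [Pi.add_apply]
    have hx := traj_diff x0 ⟨hp.1.1.le, hp.1.2⟩ hp.2.1 hp.2.2
    have hl := L_lower L hL_C1 hL_convex (traj x0 v p.1 p.2) (v p.1 p.2)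
      (traj x0 w p.1 p.2) (w p.1 p.2)
    obtain ⟨hl1, hl2⟩ := hLd (traj x0 v p.1 p.2) (v p.1 p.2)
    have hpos : 0 ≤ 1 + |v p.1 p.2| := by positivity
    rw [abs_of_nonneg hpos, abs_of_nonneg (NN_nonneg (T := T) (v := d) p.2)]
    have a1 := neg_le_of_abs_le ((abs_mul _ _).le.trans (mul_le_mul hl1 hx (abs_nonneg _) (by positivity)))
    have a2 := neg_le_of_abs_le ((abs_mul _ (w p.1 p.2 - v p.1 p.2)).le.trans
      (mul_le_mul_of_nonneg_right hl2 (abs_nonneg (w p.1 p.2 - v p.1 p.2))))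
    have a3 := neg_le_of_abs_le (abs_mul (ϖ p.1 p.2) (w p.1 p.2 - v p.1 p.2)).le
    simp only [hdd]
    linarith)
  have h2 := integral_mono_ae (hP hv) ((hP hw).add (i4.const_mul D)) (by
    filter_upwards [hv.ae_int, hw.ae_int] with ω hp hq
    simp only [Pi.add_apply]
    have hx := traj_diff x0 ⟨hT.le, le_rfl⟩ hp hq
    have hx' := traj_sub_le x0 ⟨hT.le, le_rfl⟩ hp
    have hl := psi_lower Ψ hΨ_C1 hΨ_convex (traj x0 v T ω) (traj x0 w T ω)
    have hl1 := hΨd (traj x0 v T ω)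
    have hpos : 0 ≤ 1 + (|x0| + NN T v ω) := by
      have := NN_nonneg (T := T) (v := v) ω
      positivity
    rw [abs_of_nonneg hpos, abs_of_nonneg (NN_nonneg (T := T) (v := d) ω)]
    have hl2 : |deriv Ψ (traj x0 v T ω)| ≤ D * (1 + (|x0| + NN T v ω)) := by
      refine hl1.trans (mul_le_mul_of_nonneg_left ?_ hD.le)
      have : |traj x0 v T ω| ≤ |x0| + |traj x0 v T ω - x0| := by
        have := abs_add_le x0 (traj x0 v T ω - x0)
        simpa using this
      linarith
    have a1 := neg_le_of_abs_le ((abs_mul _ _).le.trans (mul_le_mul hl2 hx (abs_nonneg _) (by positivity)))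
    simp only [hdd]
    linarith)
  rw [integral_add' (hG hw) (((i1.const_mul C).add (i2.const_mul C)).add i3),
    integral_add' ((i1.const_mul C).add (i2.const_mul C)) i3,
    integral_add' (i1.const_mul C) (i2.const_mul C), integral_const_mul, integral_const_mul] at h1
  rw [integral_add' (hP hw) (i4.const_mul D), integral_const_mul] at h2
  simp only [Pi.add_apply] at h1
  have c1 := cs_ineq hf1 hN
  have c2 := cs_ineq hf1 hd2
  have c3 := cs_ineq hϖ2 hd2
  have c4 := cs_ineq hf2 hN1
  have e1 : √(∫ p : ℝ × Ω, NN T d p.2 ^ 2 ∂(muT P T)) ≤ T * √(Q P T d) := by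
    refine (Real.sqrt_le_sqrt (NN_Q' hT hd)).trans (le_of_eq ?_)
    rw [← mul_assoc, Real.sqrt_mul (by positivity), Real.sqrt_mul_self hT.le]
  have e4 : √(∫ ω, NN T d ω ^ 2 ∂P) ≤ √T * √(Q P T d) := by
    refine (Real.sqrt_le_sqrt (NN_Q hT hd)).trans (le_of_eq ?_)
    rw [Real.sqrt_mul hT.le]
  have c1' := mul_le_mul_of_nonneg_left (c1.trans (mul_le_mul_of_nonneg_left e1 (Real.sqrt_nonneg _))) hC.le
  have c2' := mul_le_mul_of_nonneg_left c2 hC.le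
  have c4' := mul_le_mul_of_nonneg_left (c4.trans (mul_le_mul_of_nonneg_left e4 (Real.sqrt_nonneg _))) hD.le
  change _ ≤ C * (_ * √(Q P T d)) at c2'
  change _ ≤ √(Q P T ϖ) * √(Q P T d) at c3
  linarith

end

section
set_option linter.unusedSectionVars false
set_option linter.deprecated false
variable {Ω : Type*} {m : MeasurableSpace Ω} {P : Measure Ω} [IsProbabilityMeasure P] {T : ℝ}
  {𝔽 : Filtration ℝ m}
  {v w : ℝ → Ω → ℝ} {L : ℝ → ℝ → ℝ} {Ψ : ℝ → ℝ} {ϖ : ℝ → Ω → ℝ} {x0 : ℝ}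

/-- Restriction of a process to `(0,T]`. -/
def cut (T : ℝ) (v : ℝ → Ω → ℝ) : ℝ → Ω → ℝ :=
  fun t ω => (Set.Ioc (0:ℝ) T).indicator (fun t => v t ω) t

theorem cut_of_mem {t : ℝ} (ht : t ∈ Set.Ioc 0 T) (ω : Ω) : cut T v t ω = v t ω :=
  Set.indicator_of_mem ht _

theorem cut_sm (hv : ProgMeasurable 𝔽 v) : StronglyMeasurable (Function.uncurry (cut T v)) := by
  have h := hv T
  have h2 : StronglyMeasurable (fun p : Set.Iic T × Ω => v p.1 p.2) :=
    h.mono (sup_le_sup le_rfl (MeasurableSpace.comap_mono (𝔽.le T)))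
  have hg : Measurable (fun p : ℝ × Ω =>
      ((⟨min p.1 T, Set.mem_Iic.2 (min_le_right _ _)⟩ : Set.Iic T), p.2)) :=
    Measurable.prodMk (Measurable.subtype_mk (measurable_fst.min measurable_const)) measurable_snd
  have h3 := h2.comp_measurable hg
  have h4 := h3.indicator (s := Prod.fst ⁻¹' (Set.Ioc (0:ℝ) T))
    (measurable_fst measurableSet_Ioc)
  convert h4 using 1
  funext p
  by_cases hp : p.1 ∈ Set.Ioc (0:ℝ) T
  · rw [Set.indicator_of_mem (show p ∈ Prod.fst ⁻¹' (Set.Ioc (0:ℝ) T) from hp)]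
    simp only [Function.uncurry, Function.comp, min_eq_left hp.2]
    exact cut_of_mem hp _
  · rw [Set.indicator_of_notMem (show p ∉ Prod.fst ⁻¹' (Set.Ioc (0:ℝ) T) from hp)]
    exact Set.indicator_of_notMem hp (fun t => v t p.2)

theorem MemH_iff (hv : ProgMeasurable 𝔽 v) : MemH P T 𝔽 v ↔ Good P T (cut T v) := by
  have hs := cut_sm (T := T) hv
  have e : (∫⁻ ω, (∫⁻ t in Set.Ioc (0:ℝ) T, ENNReal.ofReal ((v t ω) ^ 2)) ∂P) =
      ∫⁻ p, ENNReal.ofReal ((Function.uncurry (cut T v) p) ^ 2) ∂(muT P T) := by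
    rw [lintegral_prod_symm _ ((hs.measurable.pow_const 2).ennreal_ofReal.aemeasurable)]
    refine lintegral_congr fun ω => setLIntegral_congr_fun measurableSet_Ioc fun t ht => ?_
    simp only [Function.uncurry, cut_of_mem ht]
  unfold MemH Good
  rw [e, memLp_two_iff_integrable_sq hs.aestronglyMeasurable, Integrable,
    hasFiniteIntegral_iff_ofReal (ae_of_all _ fun _ => sq_nonneg _)]
  constructor
  · rintro ⟨_, h⟩
    exact ⟨hs, (hs.pow 2).aestronglyMeasurable, h⟩
  · rintro ⟨_, _, h⟩
    exact ⟨hv, h⟩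

theorem cost_cut (hT : 0 < T) :
    cost P T L Ψ (cut T ϖ) x0 (cut T v) = cost P T L Ψ ϖ x0 v := by
  have ht : ∀ t ∈ Set.Icc 0 T, ∀ ω, traj x0 (cut T v) t ω = traj x0 v t ω := by
    intro t ht ω
    unfold traj
    rw [intervalIntegral.integral_of_le ht.1, intervalIntegral.integral_of_le ht.1]
    congr 1
    refine setIntegral_congr_fun measurableSet_Ioc fun s hs => ?_
    exact cut_of_mem ⟨hs.1, hs.2.trans ht.2⟩ ω
  unfold cost
  refine integral_congr_ae (ae_of_all _ fun ω => ?_)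
  beta_reduce
  rw [ht T ⟨hT.le, le_rfl⟩]
  congr 1
  refine setIntegral_congr_fun measurableSet_Ioc fun s hs => ?_
  rw [ht s ⟨hs.1.le, hs.2⟩, cut_of_mem hs, cut_of_mem hs]

theorem cut_ae : ∀ᵐ p ∂(muT P T), Function.uncurry (cut T v) p = v p.1 p.2 := by
  filter_upwards [ae_mu_of_ae (P := P) (T := T) (p := fun _ => True) (ae_of_all _ fun _ => trivial)]
    with p hp
  exact cut_of_mem hp.1 _

theorem prog_comb (hv : ProgMeasurable 𝔽 v) (hw : ProgMeasurable 𝔽 w) (a b : ℝ) :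
    ProgMeasurable 𝔽 (fun t ω => a * v t ω + b * w t ω) :=
  fun i => ((hv i).const_mul a).add ((hw i).const_mul b)

/-- Progressive elements of L2. -/
def SS (P : Measure Ω) (T : ℝ) (𝔽 : Filtration ℝ m) : Set (Lp ℝ 2 (muT P T)) :=
  {f | ∃ v, ProgMeasurable 𝔽 v ∧ ∀ᵐ p ∂(muT P T), f p = v p.1 p.2}

theorem SS_nonempty : (SS P T 𝔽).Nonempty := by
  refine ⟨0, fun _ _ => 0, fun i => stronglyMeasurable_const, ?_⟩
  filter_upwards [Lp.coeFn_zero ℝ 2 (muT P T)] with p hp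
  simpa using hp

theorem SS_convex : Convex ℝ (SS P T 𝔽) := by
  rintro f ⟨v, hv, hfv⟩ g ⟨w, hw, hgw⟩ a b _ _ _
  refine ⟨_, prog_comb hv hw a b, ?_⟩
  filter_upwards [hfv, hgw, Lp.coeFn_add (a • f) (b • g), Lp.coeFn_smul a f, Lp.coeFn_smul b g]
    with p h1 h2 h3 h4 h5
  rw [h3, Pi.add_apply, h4, h5, Pi.smul_apply, Pi.smul_apply, h1, h2]
  rfl

theorem limU {X : Type*} (mX : MeasurableSpace X) (u : ℕ → X → ℝ)
    (h : ∀ n, StronglyMeasurable[mX] (u n)) :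
    StronglyMeasurable[mX] (fun x => limUnder atTop (fun n => u n x)) :=
  StronglyMeasurable.limUnder h

theorem SS_closed : IsClosed (SS P T 𝔽) := by
  apply IsSeqClosed.isClosed
  intro u f hu hf
  choose v hv huv using hu
  obtain ⟨ns, _, hns⟩ := (tendstoInMeasure_of_tendsto_Lp hf).exists_seq_tendsto_ae
  refine ⟨fun t ω => limUnder atTop (fun n => v (ns n) t ω), fun i => ?_, ?_⟩
  · exact limU _ _ (fun n => hv (ns n) i)
  · filter_upwards [hns, ae_all_iff.2 huv] with p h1 h2
    simp only [h2] at h1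
    exact h1.limUnder_eq.symm

theorem lp_good (f : Lp ℝ 2 (muT P T)) : Good P T (fun t ω => f (t, ω)) :=
  ⟨Lp.stronglyMeasurable f, Lp.memLp f⟩

theorem Q_lp (f : Lp ℝ 2 (muT P T)) : Q P T (fun t ω => f (t, ω)) = ‖f‖ ^ 2 := by
  rw [← real_inner_self_eq_norm_sq, L2.inner_def]
  unfold Q
  refine integral_congr_ae (ae_of_all _ fun p => ?_)
  simp [sq]

theorem Q_congr (h : ∀ᵐ p ∂(muT P T), v p.1 p.2 = w p.1 p.2) : Q P T v = Q P T w := by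
  refine integral_congr_ae ?_
  filter_upwards [h] with p hp
  simp only [hp]

end

theorem exists_optimal_control
    {Ω : Type*} {m : MeasurableSpace Ω} (P : Measure Ω) [IsProbabilityMeasure P]
    (T : ℝ) (hT : 0 < T) (𝔽 : Filtration ℝ m)
    (L : ℝ → ℝ → ℝ) (Ψ : ℝ → ℝ)
    -- (A1): L ∈ C¹, nonnegative, jointly convex
    (hL_C1 : ContDiff ℝ 1 (Function.uncurry L))
    (hL_nonneg : ∀ x v, 0 ≤ L x v)
    (hL_convex : ConvexOn ℝ Set.univ (Function.uncurry L))
    -- (A2): Ψ ∈ C¹, nonnegative, convex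
    (hΨ_C1 : ContDiff ℝ 1 Ψ)
    (hΨ_nonneg : ∀ x, 0 ≤ Ψ x)
    (hΨ_convex : ConvexOn ℝ Set.univ Ψ)
    -- (A3): growth of Ψ and Ψ'
    (hΨ_growth : ∃ C > (0:ℝ), ∀ x, Ψ x ≤ C * (1 + |x| ^ 2))
    (hΨ'_growth : ∃ C > (0:ℝ), ∀ x, |deriv Ψ x| ≤ C * (1 + |x|))
    -- (A4): growth of L, L_x, L_v
    (hL_growth : ∃ β > (0:ℝ), ∀ x v, L x v ≤ β * (1 + |v| ^ 2))
    (hL_deriv_growth : ∃ C > (0:ℝ), ∀ x v,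
      |deriv (fun y => L y v) x| ≤ C * (1 + |v|) ∧
      |deriv (fun w => L x w) v| ≤ C * (1 + |v|))
    -- (A5): coercivity of L
    (α β : ℝ) (hα : 0 < α) (hβ : 0 ≤ β)
    (hL_coercive : ∀ x v, α * |v| ^ 2 - β ≤ L x v)
    (x0 : ℝ) (ϖ : ℝ → Ω → ℝ) (hϖ : MemH P T 𝔽 ϖ) :
    ∃ vstar, MemH P T 𝔽 vstar ∧
      ∀ v, MemH P T 𝔽 v → cost P T L Ψ ϖ x0 vstar ≤ cost P T L Ψ ϖ x0 v := by
  have hϖ' := (MemH_iff hϖ.1).1 hϖ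
  have hLc := hL_C1.continuous
  have hΨc := hΨ_C1.continuous
  -- invariance under a.e. equality
  have hlow := fun {v} (hv : Good P T v) => cost_lower (x0 := x0) hT hL_C1 hL_nonneg hL_growth
    hΨ_C1 hΨ_nonneg hΨ_growth hϖ' hL_convex hΨ_convex hΨ'_growth hL_deriv_growth hv
  have hle : ∀ v w, Good P T v → Good P T w → (∀ᵐ p ∂(muT P T), v p.1 p.2 = w p.1 p.2) →
      cost P T L Ψ (cut T ϖ) x0 v ≤ cost P T L Ψ (cut T ϖ) x0 w := by
    intro v w hv hw hvw
    obtain ⟨A, hA⟩ := hlow hv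
    have h := hA w hw
    have h0 : Q P T (fun t ω => w t ω - v t ω) = 0 := by
      rw [Q_congr (w := fun _ _ => 0)]
      · simp [Q]
      · filter_upwards [hvw] with p hp
        simp [hp]
    simpa [h0] using h
  have heq : ∀ v w, Good P T v → Good P T w → (∀ᵐ p ∂(muT P T), v p.1 p.2 = w p.1 p.2) →
      cost P T L Ψ (cut T ϖ) x0 v = cost P T L Ψ (cut T ϖ) x0 w := fun v w hv hw h =>
    le_antisymm (hle v w hv hw h) (hle w v hw hv (h.mono fun _ hp => hp.symm))
  obtain ⟨f, ⟨v, hv, hfv⟩, hmin⟩ := abstract_min (SS P T 𝔽) SS_nonempty SS_closed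
    (fun f => cost P T L Ψ (cut T ϖ) x0 (fun t ω => f (t, ω)))
    (by
      refine ⟨SS_convex, fun f _ g _ a b ha hb hab => ?_⟩
      have h := cost_convex (x0 := x0) hT hLc hL_nonneg hL_growth hΨc hΨ_nonneg hΨ_growth hϖ'
        hL_convex hΨ_convex (lp_good f) (lp_good g) a b ha hb hab
      refine le_trans (hle _ _ (lp_good _) ((lp_good f).comb (lp_good g) a b) ?_) h
      filter_upwards [Lp.coeFn_add (a • f) (b • g), Lp.coeFn_smul a f, Lp.coeFn_smul b g]
        with p h3 h4 h5
      change (a • f + b • g : Lp ℝ 2 (muT P T)) p = a * f p + b * g p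
      rw [h3, Pi.add_apply, h4, h5, Pi.smul_apply, Pi.smul_apply]
      rfl)
    (by
      intro f _
      obtain ⟨A, hA⟩ := hlow (lp_good f)
      refine ⟨A, fun g _ => ?_⟩
      have h := hA _ (lp_good g)
      have e : Q P T (fun t ω => g (t, ω) - f (t, ω)) = ‖g - f‖ ^ 2 := by
        rw [← Q_lp]
        refine Q_congr ?_
        filter_upwards [Lp.coeFn_sub g f] with p hp
        exact hp.symm
      rwa [e, Real.sqrt_sq (norm_nonneg _)] at h)
    (α / 2) (β * T + 1 / (2 * α) * Q P T (cut T ϖ)) (by positivity)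
    (by
      intro f _
      have := cost_coercive (x0 := x0) hT hLc hL_nonneg hL_growth hΨc hΨ_nonneg hΨ_growth hϖ'
        α β hα hL_coercive (lp_good f)
      rwa [Q_lp] at this)
  have hae : ∀ᵐ p ∂(muT P T), Function.uncurry (cut T v) p = f p := by
    filter_upwards [hfv, cut_ae (P := P) (T := T) (v := v)] with p h1 h2
    rw [h1, h2]
  have hgv : Good P T (cut T v) :=
    ⟨cut_sm hv, (memLp_congr_ae hae).2 (Lp.memLp f)⟩
  refine ⟨v, (MemH_iff hv).2 hgv, fun w hw => ?_⟩
  have hgw := (MemH_iff hw.1).1 hw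
  rw [← cost_cut hT (v := v), ← cost_cut hT (v := w)]
  have h1 := hmin (hgw.2.toLp _) ⟨w, hw.1, by
    filter_upwards [hgw.2.coeFn_toLp, cut_ae (P := P) (T := T) (v := w)] with p h1 h2
    rw [h1, h2]⟩
  calc cost P T L Ψ (cut T ϖ) x0 (cut T v) = _ := heq _ (fun t ω => f (t, ω)) hgv (lp_good f) hae
    _ ≤ _ := h1
    _ = _ := heq _ _ (lp_good _) hgw hgw.2.coeFn_toLp
end
end

section
/- Suppose assumptions (A1)–(A6) hold. Given an initial condition x_0 ∈ ℝ and a price process ϖ ∈ H_𝔽, the minimizer of I over H_𝔽 is unique: if v* and ṽ both minimize I over H_𝔽, then v* = ṽ as elements of H_𝔽 (i.e. v* = ṽ (dt⊗dP)-a.e.), and consequently their trajectories coincide. -/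
/- STATEMENT 4: Uniqueness of the minimizer of I on H_𝔽 under (A1)-(A6):
   two minimizers coincide (dt⊗dP)-a.e., and their trajectories coincide. -/

open MeasureTheory

noncomputable section

/-- The product measure dt ⊗ dP on (0,T] × Ω. -/
def timeProd {Ω : Type*} {_m : MeasurableSpace Ω} (P : Measure Ω) (T : ℝ) :
    Measure (ℝ × Ω) :=
  (volume.restrict (Set.Ioc (0:ℝ) T)).prod P

lemma aux_const (f : ℝ → ℝ) (hf : ConvexOn ℝ Set.univ f) (B : ℝ) (hB : ∀ x, f x ≤ B)
    (x y : ℝ) : f y ≤ f x := by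
  by_contra! h
  obtain ⟨n, hn⟩ := exists_nat_gt ((B - f x) / (f y - f x))
  have hd : 0 < f y - f x := by linarith
  rw [div_lt_iff₀ hd] at hn
  have hB' := hB x
  have hn0 : (0:ℝ) < n := by
    by_contra! h0
    nlinarith
  have hn1 : (1:ℝ) ≤ n := by
    have : 0 < n := by exact_mod_cast hn0
    exact_mod_cast this
  have := hf.2 (Set.mem_univ x) (Set.mem_univ (x + n * (y - x)))
    (by rw [sub_nonneg, div_le_one hn0]; exact hn1 : (0:ℝ) ≤ 1 - 1 / (n:ℝ))
    (by positivity : (0:ℝ) ≤ 1 / (n:ℝ)) (by ring)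
  have e : (1 - 1 / (n:ℝ)) • x + (1 / (n:ℝ)) • (x + n * (y - x)) = y := by
    simp only [smul_eq_mul]; field_simp; ring
  rw [e] at this
  simp only [smul_eq_mul] at this
  have h2 := hB (x + n * (y - x))
  have h3 : f y ≤ (1 - 1 / (n:ℝ)) * f x + 1 / n * B := by
    have : 0 ≤ 1 / (n:ℝ) := by positivity
    nlinarith
  have h4 : n * f y ≤ n * ((1 - 1 / (n:ℝ)) * f x + 1 / n * B) := by gcongr
  have h5 : n * ((1 - 1 / (n:ℝ)) * f x + 1 / n * B) = n * f x - f x + B := by field_simp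
  nlinarith

lemma aux_meas {Ω : Type*} {m : MeasurableSpace Ω} (P : Measure Ω) [IsProbabilityMeasure P]
    (T : ℝ) (𝔽 : Filtration ℝ m) (v : ℝ → Ω → ℝ) (hv : ProgMeasurable 𝔽 v) :
    AEStronglyMeasurable (fun p : Ω × ℝ => v p.2 p.1)
      (P.prod (volume.restrict (Set.Ioc (0:ℝ) T))) := by
  have h1 : StronglyMeasurable (fun p : Set.Iic T × Ω => v p.1 p.2) := by
    refine (hv T).mono ?_
    exact sup_le_sup le_rfl (MeasurableSpace.comap_mono (𝔽.le T))
  have h2 : Measurable (fun p : Ω × ℝ => ((⟨min p.2 T, Set.mem_Iic.2 (min_le_right _ _)⟩ : Set.Iic T), p.1)) := by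
    fun_prop
  refine ⟨_, h1.comp_measurable h2, ?_⟩
  have h3 : ∀ᵐ p ∂(P.prod (volume.restrict (Set.Ioc (0:ℝ) T))), p.2 ∈ Set.Ioc (0:ℝ) T :=
    Measure.quasiMeasurePreserving_snd.ae (ae_restrict_mem measurableSet_Ioc)
  filter_upwards [h3] with p hp
  simp [Function.comp, min_eq_left hp.2]

lemma aux_memLp {Ω : Type*} {m : MeasurableSpace Ω} (P : Measure Ω) [IsProbabilityMeasure P]
    (T : ℝ) (𝔽 : Filtration ℝ m) (v : ℝ → Ω → ℝ) (hv : MemH P T 𝔽 v) :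
    MemLp (fun p : Ω × ℝ => v p.2 p.1) 2 (P.prod (volume.restrict (Set.Ioc (0:ℝ) T))) := by
  have hm := aux_meas P T 𝔽 v hv.1
  rw [memLp_two_iff_integrable_sq hm]
  refine ⟨hm.pow 2, ?_⟩
  rw [hasFiniteIntegral_iff_ofReal (Filter.Eventually.of_forall fun p => sq_nonneg _),
    lintegral_prod (fun p : Ω × ℝ => ENNReal.ofReal (v p.2 p.1 ^ 2))
      (hm.pow 2).aemeasurable.ennreal_ofReal]
  exact hv.2

lemma aux_memH {Ω : Type*} {m : MeasurableSpace Ω} (P : Measure Ω) [IsProbabilityMeasure P]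
    (T : ℝ) (𝔽 : Filtration ℝ m) (v w : ℝ → Ω → ℝ) (hv : MemH P T 𝔽 v) (hw : MemH P T 𝔽 w) :
    MemH P T 𝔽 (fun t ω => (1/2) * v t ω + (1/2) * w t ω) := by
  have hp : ProgMeasurable 𝔽 (fun t ω => (1/2) * v t ω + (1/2) * w t ω) := by
    intro i
    exact ((hv.1 i).const_mul (1/2)).add ((hw.1 i).const_mul (1/2))
  refine ⟨hp, ?_⟩
  have hm := aux_meas P T 𝔽 _ hp
  have h := (((aux_memLp P T 𝔽 v hv).const_mul (1/2)).add
    ((aux_memLp P T 𝔽 w hw).const_mul (1/2))).integrable_sq.2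
  rw [hasFiniteIntegral_iff_ofReal (Filter.Eventually.of_forall fun p => sq_nonneg _)] at h
  have e := lintegral_prod (μ := P) (ν := volume.restrict (Set.Ioc (0:ℝ) T))
     _ (hm.pow 2).aemeasurable.ennreal_ofReal
  exact (e.symm.le).trans_lt h

lemma aux_traj {Ω : Type*} {m : MeasurableSpace Ω} (P : Measure Ω) [IsProbabilityMeasure P]
    (T : ℝ) (hT : 0 < T) (𝔽 : Filtration ℝ m) (v : ℝ → Ω → ℝ) (hv : MemH P T 𝔽 v) (x0 : ℝ) :
    MemLp (fun ω => traj x0 v T ω) 2 P := by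
  have h := aux_memLp P T 𝔽 v hv
  have hm := h.1.integral_prod_right'
  have hm' : AEStronglyMeasurable (fun ω => ∫ s in (0:ℝ)..T, v s ω) P := by
    simpa only [intervalIntegral.integral_of_le hT.le] using hm
  refine (memLp_const x0).add ?_
  rw [memLp_two_iff_integrable_sq hm']
  have hsq := h.integrable_sq
  refine Integrable.mono' (hsq.integral_prod_left.const_mul T) (hm'.pow 2) ?_
  filter_upwards [hsq.prod_right_ae, h.1.prodMk_left] with ω hω hmω
  rw [Real.norm_of_nonneg (sq_nonneg _), intervalIntegral.integral_of_le hT.le]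
  have hL2 : MemLp (fun t => v t ω) 2 (volume.restrict (Set.Ioc (0:ℝ) T)) :=
    (memLp_two_iff_integrable_sq hmω).2 hω
  have hi : Integrable (fun t => v t ω) (volume.restrict (Set.Ioc (0:ℝ) T)) :=
    hL2.integrable (by norm_num)
  set c := ∫ t in Set.Ioc (0:ℝ) T, v t ω with hc
  have h0 : 0 ≤ ∫ t in Set.Ioc (0:ℝ) T, (T * v t ω - c) ^ 2 := integral_nonneg fun t => sq_nonneg _
  have e : ∫ t in Set.Ioc (0:ℝ) T, (T * v t ω - c) ^ 2 =
      T^2 * (∫ t in Set.Ioc (0:ℝ) T, (v t ω)^2) - 2 * T * c * c + c^2 * T := by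
    have : ∀ t, (T * v t ω - c) ^ 2 = T^2 * (v t ω)^2 - 2 * T * c * v t ω + c^2 := by
      intro t; ring
    simp only [this]
    have hs : Integrable (fun t => T^2 * (v t ω)^2 - 2 * T * c * v t ω)
        (volume.restrict (Set.Ioc (0:ℝ) T)) := (hω.const_mul _).sub (hi.const_mul _)
    rw [integral_add hs (integrable_const _),
      integral_sub (hω.const_mul _) (hi.const_mul _), integral_const_mul, integral_const_mul, ← hc]
    simp [hT.le]; ring
  rw [e] at h0
  have : 0 ≤ T * (T * (∫ t in Set.Ioc (0:ℝ) T, (v t ω)^2) - c^2) := by linarith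
  have := nonneg_of_mul_nonneg_right this hT
  linarith

lemma aux_run {Ω : Type*} {m : MeasurableSpace Ω} (P : Measure Ω) [IsProbabilityMeasure P]
    (T : ℝ) (𝔽 : Filtration ℝ m) (l : ℝ → ℝ) (hl : Continuous l) (hl0 : ∀ v, 0 ≤ l v)
    (β : ℝ) (hβ : ∀ v, l v ≤ β * (1 + |v| ^ 2))
    (ϖ v : ℝ → Ω → ℝ) (hϖ : MemH P T 𝔽 ϖ) (hv : MemH P T 𝔽 v) :
    Integrable (fun p : Ω × ℝ => l (v p.2 p.1) + ϖ p.2 p.1 * v p.2 p.1)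
      (P.prod (volume.restrict (Set.Ioc (0:ℝ) T))) := by
  have h := aux_memLp P T 𝔽 v hv
  have h' := aux_memLp P T 𝔽 ϖ hϖ
  refine Integrable.add ?_ (h'.integrable_mul h)
  refine Integrable.mono' (((integrable_const (1:ℝ)).add h.integrable_sq).const_mul β)
    (hl.comp_aestronglyMeasurable h.1) ?_
  refine Filter.Eventually.of_forall fun p => ?_
  rw [Real.norm_of_nonneg (hl0 _)]
  simpa [sq_abs] using hβ (v p.2 p.1)

lemma aux_term {Ω : Type*} {m : MeasurableSpace Ω} (P : Measure Ω) [IsProbabilityMeasure P]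
    (T : ℝ) (hT : 0 < T) (𝔽 : Filtration ℝ m) (Ψ : ℝ → ℝ) (hl : Continuous Ψ)
    (hl0 : ∀ v, 0 ≤ Ψ v)
    (β : ℝ) (hβ : ∀ v, Ψ v ≤ β * (1 + |v| ^ 2)) (x0 : ℝ)
    (v : ℝ → Ω → ℝ) (hv : MemH P T 𝔽 v) :
    Integrable (fun ω => Ψ (traj x0 v T ω)) P := by
  have h := aux_traj P T hT 𝔽 v hv x0
  refine Integrable.mono' (((integrable_const (1:ℝ)).add h.integrable_sq).const_mul β)
    (hl.comp_aestronglyMeasurable h.1) ?_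
  refine Filter.Eventually.of_forall fun p => ?_
  rw [Real.norm_of_nonneg (hl0 _)]
  simpa [sq_abs] using hβ (traj x0 v T p)

theorem optimal_control_unique
    {Ω : Type*} {m : MeasurableSpace Ω} (P : Measure Ω) [IsProbabilityMeasure P]
    (T : ℝ) (hT : 0 < T) (𝔽 : Filtration ℝ m)
    (L : ℝ → ℝ → ℝ) (Ψ : ℝ → ℝ)
    -- (A1): L ∈ C¹, nonnegative, jointly convex
    (hL_C1 : ContDiff ℝ 1 (Function.uncurry L))
    (hL_nonneg : ∀ x v, 0 ≤ L x v)
    (hL_convex : ConvexOn ℝ Set.univ (Function.uncurry L))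
    -- (A2): Ψ ∈ C¹, nonnegative, convex
    (hΨ_C1 : ContDiff ℝ 1 Ψ)
    (hΨ_nonneg : ∀ x, 0 ≤ Ψ x)
    (hΨ_convex : ConvexOn ℝ Set.univ Ψ)
    -- (A3): growth of Ψ and Ψ'
    (hΨ_growth : ∃ C > (0:ℝ), ∀ x, Ψ x ≤ C * (1 + |x| ^ 2))
    (hΨ'_growth : ∃ C > (0:ℝ), ∀ x, |deriv Ψ x| ≤ C * (1 + |x|))
    -- (A4): growth of L, L_x, L_v
    (hL_growth : ∃ β > (0:ℝ), ∀ x v, L x v ≤ β * (1 + |v| ^ 2))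
    (hL_deriv_growth : ∃ C > (0:ℝ), ∀ x v,
      |deriv (fun y => L y v) x| ≤ C * (1 + |v|) ∧
      |deriv (fun w => L x w) v| ≤ C * (1 + |v|))
    -- (A5): coercivity of L
    (α β : ℝ) (hα : 0 < α) (hβ : 0 ≤ β)
    (hL_coercive : ∀ x v, α * |v| ^ 2 - β ≤ L x v)
    -- (A6): uniform convexity of L in v
    (hL_unif_convex : ∃ θ > (0:ℝ), ∀ x,
      ConvexOn ℝ Set.univ (fun v => L x v - θ / 2 * v ^ 2))
    (x0 : ℝ) (ϖ : ℝ → Ω → ℝ) (hϖ : MemH P T 𝔽 ϖ)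
    (vstar vtil : ℝ → Ω → ℝ)
    (hvstar : MemH P T 𝔽 vstar) (hvtil : MemH P T 𝔽 vtil)
    (hmin_star : ∀ v, MemH P T 𝔽 v → cost P T L Ψ ϖ x0 vstar ≤ cost P T L Ψ ϖ x0 v)
    (hmin_til : ∀ v, MemH P T 𝔽 v → cost P T L Ψ ϖ x0 vtil ≤ cost P T L Ψ ϖ x0 v) :
    (fun p : ℝ × Ω => vstar p.1 p.2) =ᵐ[timeProd P T] (fun p => vtil p.1 p.2) ∧
      ∀ t ∈ Set.Icc (0:ℝ) T,
        (fun ω => traj x0 vstar t ω) =ᵐ[P] fun ω => traj x0 vtil t ω := by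
  obtain ⟨CΨ, _, hΨg⟩ := hΨ_growth
  obtain ⟨β', _, hLg⟩ := hL_growth
  obtain ⟨θ, hθ, hUC⟩ := hL_unif_convex
  -- L does not depend on x
  have hconv : ∀ v, ConvexOn ℝ Set.univ (fun x => L x v) := by
    intro v
    refine ⟨convex_univ, fun x _ y _ a b ha hb hab => ?_⟩
    have := hL_convex.2 (Set.mem_univ (x, v)) (Set.mem_univ (y, v)) ha hb hab
    have e : a • ((x, v) : ℝ × ℝ) + b • ((y, v) : ℝ × ℝ) = (a • x + b • y, v) := by
      ext
      · simp
      · simp [← add_mul, hab]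
    rw [e] at this
    exact this
  have hLx : ∀ x v, L x v = L 0 v := fun x v =>
    le_antisymm (aux_const _ (hconv v) _ (fun x => hLg x v) 0 x)
      (aux_const _ (hconv v) _ (fun x => hLg x v) x 0)
  have hlc : Continuous (L 0) := by
    have := hL_C1.continuous
    exact this.comp (by fun_prop : Continuous fun v : ℝ => ((0:ℝ), v))
  have hstrong : ∀ a b : ℝ, L 0 (1/2 * a + 1/2 * b) ≤
      1/2 * L 0 a + 1/2 * L 0 b - θ / 8 * (a - b) ^ 2 := by
    intro a b
    have := (hUC 0).2 (Set.mem_univ a) (Set.mem_univ b)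
      (by norm_num : (0:ℝ) ≤ 1/2) (by norm_num : (0:ℝ) ≤ 1/2) (by norm_num)
    simp only [smul_eq_mul] at this
    nlinarith
  have hcost : ∀ v, MemH P T 𝔽 v → cost P T L Ψ ϖ x0 v =
      (∫ p, (L 0 (v p.2 p.1) + ϖ p.2 p.1 * v p.2 p.1)
        ∂(P.prod (volume.restrict (Set.Ioc (0:ℝ) T)))) + ∫ ω, Ψ (traj x0 v T ω) ∂P := by
    intro v hv
    have h1 := aux_run P T 𝔽 (L 0) hlc (hL_nonneg 0) β' (hLg 0) ϖ v hϖ hv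
    have h2 := aux_term P T hT 𝔽 Ψ hΨ_C1.continuous hΨ_nonneg CΨ hΨg x0 v hv
    unfold cost
    simp only [hLx (traj _ _ _ _)]
    rw [integral_add h1.integral_prod_left h2, integral_prod _ h1]
  set ν := P.prod (volume.restrict (Set.Ioc (0:ℝ) T)) with hν
  have hu := aux_memH P T 𝔽 vstar vtil hvstar hvtil
  set u : ℝ → Ω → ℝ := fun t ω => (1/2) * vstar t ω + (1/2) * vtil t ω with hudef
  have ha := aux_memLp P T 𝔽 vstar hvstar
  have hb := aux_memLp P T 𝔽 vtil hvtil
  have hd : Integrable (fun p : Ω × ℝ => (vstar p.2 p.1 - vtil p.2 p.1) ^ 2) ν :=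
    (ha.sub hb).integrable_sq
  have ra := aux_run P T 𝔽 (L 0) hlc (hL_nonneg 0) β' (hLg 0) ϖ vstar hϖ hvstar
  have rb := aux_run P T 𝔽 (L 0) hlc (hL_nonneg 0) β' (hLg 0) ϖ vtil hϖ hvtil
  have ru := aux_run P T 𝔽 (L 0) hlc (hL_nonneg 0) β' (hLg 0) ϖ u hϖ hu
  have ta := aux_term P T hT 𝔽 Ψ hΨ_C1.continuous hΨ_nonneg CΨ hΨg x0 vstar hvstar
  have tb := aux_term P T hT 𝔽 Ψ hΨ_C1.continuous hΨ_nonneg CΨ hΨg x0 vtil hvtil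
  have tu := aux_term P T hT 𝔽 Ψ hΨ_C1.continuous hΨ_nonneg CΨ hΨg x0 u hu
  have hrun : ∫ p, (L 0 (u p.2 p.1) + ϖ p.2 p.1 * u p.2 p.1) ∂ν ≤
      1/2 * (∫ p, (L 0 (vstar p.2 p.1) + ϖ p.2 p.1 * vstar p.2 p.1) ∂ν) +
      1/2 * (∫ p, (L 0 (vtil p.2 p.1) + ϖ p.2 p.1 * vtil p.2 p.1) ∂ν) -
      θ / 8 * ∫ p, (vstar p.2 p.1 - vtil p.2 p.1) ^ 2 ∂ν := by
    have hs : Integrable (fun p : Ω × ℝ =>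
        1/2 * (L 0 (vstar p.2 p.1) + ϖ p.2 p.1 * vstar p.2 p.1) +
        1/2 * (L 0 (vtil p.2 p.1) + ϖ p.2 p.1 * vtil p.2 p.1)) ν :=
      (ra.const_mul _).add (rb.const_mul _)
    rw [← integral_const_mul, ← integral_const_mul, ← integral_const_mul,
      ← integral_add (ra.const_mul _) (rb.const_mul _),
      ← integral_sub hs (hd.const_mul _)]
    refine integral_mono ru (hs.sub (hd.const_mul _)) ?_
    intro p
    have := hstrong (vstar p.2 p.1) (vtil p.2 p.1)
    simp only [hudef, Pi.add_apply, Pi.sub_apply]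
    linarith
  have hia : ∀ᵐ ω ∂P, IntervalIntegrable (fun t => vstar t ω) volume 0 T := by
    filter_upwards [(ha.integrable (by norm_num)).prod_right_ae] with ω h
    rw [intervalIntegrable_iff_integrableOn_Ioc_of_le hT.le]
    exact h
  have hib : ∀ᵐ ω ∂P, IntervalIntegrable (fun t => vtil t ω) volume 0 T := by
    filter_upwards [(hb.integrable (by norm_num)).prod_right_ae] with ω h
    rw [intervalIntegrable_iff_integrableOn_Ioc_of_le hT.le]
    exact h
  have hterm : ∫ ω, Ψ (traj x0 u T ω) ∂P ≤
      1/2 * (∫ ω, Ψ (traj x0 vstar T ω) ∂P) + 1/2 * (∫ ω, Ψ (traj x0 vtil T ω) ∂P) := by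
    rw [← integral_const_mul, ← integral_const_mul,
      ← integral_add (ta.const_mul _) (tb.const_mul _)]
    refine integral_mono_ae tu ((ta.const_mul _).add (tb.const_mul _)) ?_
    filter_upwards [hia, hib] with ω h1 h2
    have e : traj x0 u T ω = (1/2 : ℝ) • traj x0 vstar T ω + (1/2 : ℝ) • traj x0 vtil T ω := by
      simp only [traj, hudef, smul_eq_mul]
      rw [intervalIntegral.integral_add (h1.const_mul _) (h2.const_mul _),
        intervalIntegral.integral_const_mul, intervalIntegral.integral_const_mul]
      ring
    rw [e]
    exact hΨ_convex.2 (Set.mem_univ _) (Set.mem_univ _) (by norm_num) (by norm_num) (by norm_num)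
  have m1 := hmin_star u hu
  have m2 := hmin_til u hu
  rw [hcost _ hu, hcost _ hvstar] at m1
  rw [hcost _ hu, hcost _ hvtil] at m2
  have hz : ∫ p, (vstar p.2 p.1 - vtil p.2 p.1) ^ 2 ∂ν = 0 := by
    refine le_antisymm ?_ (integral_nonneg fun p => sq_nonneg _)
    have : θ / 8 * ∫ p, (vstar p.2 p.1 - vtil p.2 p.1) ^ 2 ∂ν ≤ 0 := by linarith
    by_contra! h
    have := mul_pos (by positivity : 0 < θ / 8) h
    linarith
  have hae : ∀ᵐ p ∂ν, vstar p.2 p.1 = vtil p.2 p.1 := by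
    have := (integral_eq_zero_iff_of_nonneg (fun p => sq_nonneg _) hd).1 hz
    filter_upwards [this] with p hp
    simp only [Pi.zero_apply, Pi.sub_apply] at hp
    exact sub_eq_zero.1 (pow_eq_zero_iff (by norm_num) |>.1 hp)
  constructor
  · have := (Measure.measurePreserving_swap (μ := volume.restrict (Set.Ioc (0:ℝ) T))
      (ν := P)).quasiMeasurePreserving.ae hae
    exact this
  · intro t ht
    filter_upwards [Measure.ae_ae_of_ae_prod hae] with ω hω
    simp only [traj]
    congr 1
    rw [intervalIntegral.integral_of_le ht.1, intervalIntegral.integral_of_le ht.1]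
    refine integral_congr_ae ?_
    exact ae_restrict_of_ae_restrict_of_subset (Set.Ioc_subset_Ioc_right ht.2) hω
end
end

section
/- (Weak Euler–Lagrange equation.) Suppose L ∈ C¹(ℝ²;ℝ) and Ψ ∈ C¹(ℝ;ℝ) satisfy the growth assumptions (A3) and (A4). Let x_0 ∈ ℝ, ϖ ∈ H_𝔽, and let v* ∈ H_𝔽 minimize I over H_𝔽, with trajectory X*_t = x_0 + ∫_0^t v*_s ds. Then for every δv ∈ H_𝔽, setting δX_t := ∫_0^t δv_s ds, one has E[∫_0^T (L_x(X*_t, v*_t) δX_t + (L_v(X*_t, v*_t) + ϖ_t) δv_t) dt + Ψ'(X*_T) δX_T] = 0. -/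
/- STATEMENT 5: Weak Euler–Lagrange equation satisfied by a minimizer of I
   under the growth assumptions (A3) and (A4). -/

open MeasureTheory

noncomputable section

/-- Partial derivative of L in the state variable. -/
def Lx (L : ℝ → ℝ → ℝ) (x v : ℝ) : ℝ := deriv (fun y => L y v) x

/-- Partial derivative of L in the velocity variable. -/
def Lv (L : ℝ → ℝ → ℝ) (x v : ℝ) : ℝ := deriv (fun w => L x w) v

lemma WEL_deriv (L : ℝ → ℝ → ℝ) (hL : ContDiff ℝ 1 (Function.uncurry L)) (x y v d e : ℝ) :
    HasDerivAt (fun e : ℝ => L (x + e * y) (v + e * d))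
      (Lx L (x + e * y) (v + e * d) * y + Lv L (x + e * y) (v + e * d) * d) e := by
  have hd : Differentiable ℝ (Function.uncurry L) := hL.differentiable (by norm_num)
  have hF := (hd (x + e * y, v + e * d)).hasFDerivAt
  set A := fderiv ℝ (Function.uncurry L) (x + e * y, v + e * d) with hA
  have h1 : Lx L (x + e * y) (v + e * d) = A (1, 0) := by
    have hg : HasDerivAt (fun z : ℝ => (z, v + e * d)) ((1 : ℝ), (0 : ℝ)) (x + e * y) :=
      (hasDerivAt_id _).prodMk (hasDerivAt_const _ _)
    exact (HasFDerivAt.comp_hasDerivAt (x + e * y) hF hg).deriv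
  have h2 : Lv L (x + e * y) (v + e * d) = A (0, 1) := by
    have hg : HasDerivAt (fun z : ℝ => (x + e * y, z)) ((0 : ℝ), (1 : ℝ)) (v + e * d) :=
      (hasDerivAt_const _ _).prodMk (hasDerivAt_id _)
    exact (HasFDerivAt.comp_hasDerivAt (v + e * d) hF hg).deriv
  have h3 : HasDerivAt (fun z : ℝ => (x + z * y, v + z * d)) (y, d) e := by
    refine HasDerivAt.prodMk ?_ ?_
    · simpa using ((hasDerivAt_id e).mul_const y).const_add x
    · simpa using ((hasDerivAt_id e).mul_const d).const_add v
  have h4 := HasFDerivAt.comp_hasDerivAt e hF h3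
  have h5 : Lx L (x + e * y) (v + e * d) * y + Lv L (x + e * y) (v + e * d) * d = A (y, d) := by
    have : ((y, d) : ℝ × ℝ) = y • ((1 : ℝ), (0 : ℝ)) + d • ((0 : ℝ), (1 : ℝ)) := by simp
    rw [this, map_add, map_smul, map_smul, h1, h2, smul_eq_mul, smul_eq_mul]; ring
  rw [h5]
  exact h4

lemma WEL_bound (L : ℝ → ℝ → ℝ) (hL : ContDiff ℝ 1 (Function.uncurry L)) (C : ℝ) (hC : 0 < C)
    (hb : ∀ x v, |Lx L x v| ≤ C * (1 + |v|) ∧ |Lv L x v| ≤ C * (1 + |v|)) (x v : ℝ) :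
    |L x v| ≤ |L 0 0| + C * (1 + |v|) * (|x| + |v|) := by
  have h := norm_image_sub_le_of_norm_deriv_le_segment_01' (f := fun e : ℝ => L (0 + e * x) (0 + e * v))
    (C := C * (1 + |v|) * (|x| + |v|))
    (fun e _ => (WEL_deriv L hL 0 x 0 v e).hasDerivWithinAt) (by
      intro e he
      obtain ⟨h1, h2⟩ := hb (0 + e * x) (0 + e * v)
      have hv : |0 + e * v| ≤ |v| := by
        rw [zero_add, abs_mul, abs_of_nonneg he.1]
        exact mul_le_of_le_one_left (abs_nonneg _) he.2.le
      have h3 : C * (1 + |0 + e * v|) ≤ C * (1 + |v|) := by gcongr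
      rw [Real.norm_eq_abs]
      calc _ ≤ _ := abs_add_le _ _
        _ ≤ C * (1 + |v|) * |x| + C * (1 + |v|) * |v| := by
            rw [abs_mul, abs_mul]
            gcongr
            · exact h1.trans h3
            · exact h2.trans h3
        _ = _ := by ring)
  simp only [one_mul, zero_mul, zero_add, Real.norm_eq_abs] at h
  have := abs_sub_abs_le_abs_sub (L x v) (L 0 0)
  linarith

lemma WEL_contLx (L : ℝ → ℝ → ℝ) (hL : ContDiff ℝ 1 (Function.uncurry L)) :
    Continuous (fun p : ℝ × ℝ => Lx L p.1 p.2) ∧ Continuous (fun p : ℝ × ℝ => Lv L p.1 p.2) := by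
  have hd : Differentiable ℝ (Function.uncurry L) := hL.differentiable (by norm_num)
  have hc : Continuous (fderiv ℝ (Function.uncurry L)) := hL.continuous_fderiv (by norm_num)
  constructor
  · have : (fun p : ℝ × ℝ => Lx L p.1 p.2) = fun p => fderiv ℝ (Function.uncurry L) p (1, 0) := by
      funext p
      have hg : HasDerivAt (fun z : ℝ => (z, p.2)) ((1 : ℝ), (0 : ℝ)) p.1 :=
        (hasDerivAt_id _).prodMk (hasDerivAt_const _ _)
      exact (HasFDerivAt.comp_hasDerivAt p.1 (hd p).hasFDerivAt hg).deriv
    rw [this]; fun_prop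
  · have : (fun p : ℝ × ℝ => Lv L p.1 p.2) = fun p => fderiv ℝ (Function.uncurry L) p (0, 1) := by
      funext p
      have hg : HasDerivAt (fun z : ℝ => (p.1, z)) ((0 : ℝ), (1 : ℝ)) p.2 :=
        (hasDerivAt_const _ _).prodMk (hasDerivAt_id _)
      exact (HasFDerivAt.comp_hasDerivAt p.2 (hd p).hasFDerivAt hg).deriv
    rw [this]; fun_prop

lemma WEL_integrable {α : Type*} {mα : MeasurableSpace α} (ν : Measure α) [IsFiniteMeasure ν]
    (L : ℝ → ℝ → ℝ) (hL : ContDiff ℝ 1 (Function.uncurry L)) (C : ℝ) (hC : 0 < C)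
    (hb : ∀ x v, |Lx L x v| ≤ C * (1 + |v|) ∧ |Lv L x v| ≤ C * (1 + |v|))
    (X V W : α → ℝ) (hX : MemLp X 2 ν) (hV : MemLp V 2 ν) (hW : MemLp W 2 ν) :
    Integrable (fun a => L (X a) (V a) + W a * V a) ν := by
  refine Integrable.add ?_ (hW.integrable_mul hV)
  have hmeas : AEStronglyMeasurable (fun a => L (X a) (V a)) ν :=
    hL.continuous.comp_aestronglyMeasurable (hX.1.prodMk hV.1)
  have h1 : MemLp (fun a => 1 + |V a|) 2 ν := (memLp_const (1:ℝ)).add hV.abs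
  have h2 : MemLp (fun a => |X a| + |V a|) 2 ν := hX.abs.add hV.abs
  have hi : Integrable (fun a => |L 0 0| + C * ((1 + |V a|) * (|X a| + |V a|))) ν :=
    (integrable_const _).add ((h1.integrable_mul h2).const_mul C)
  refine hi.mono' hmeas (Filter.Eventually.of_forall fun a => ?_)
  have := WEL_bound L hL C hC hb (X a) (V a)
  rw [Real.norm_eq_abs]; linarith

lemma WEL_main {α : Type*} {mα : MeasurableSpace α} (ν : Measure α) [IsFiniteMeasure ν]
    (L : ℝ → ℝ → ℝ) (hL : ContDiff ℝ 1 (Function.uncurry L)) (C : ℝ) (hC : 0 < C)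
    (hb : ∀ x v, |Lx L x v| ≤ C * (1 + |v|) ∧ |Lv L x v| ≤ C * (1 + |v|))
    (X Y V D W : α → ℝ) (hX : MemLp X 2 ν) (hY : MemLp Y 2 ν) (hV : MemLp V 2 ν)
    (hD : MemLp D 2 ν) (hW : MemLp W 2 ν) :
    Integrable (fun a => Lx L (X a) (V a) * Y a + (Lv L (X a) (V a) + W a) * D a) ν ∧
    HasDerivAt (fun e : ℝ => ∫ a, (L (X a + e * Y a) (V a + e * D a) + W a * (V a + e * D a)) ∂ν)
      (∫ a, (Lx L (X a) (V a) * Y a + (Lv L (X a) (V a) + W a) * D a) ∂ν) 0 := by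
  have hXe : ∀ e : ℝ, MemLp (fun a => X a + e * Y a) 2 ν := fun e => hX.add (hY.const_mul e)
  have hVe : ∀ e : ℝ, MemLp (fun a => V a + e * D a) 2 ν := fun e => hV.add (hD.const_mul e)
  obtain ⟨hcx, hcv⟩ := WEL_contLx L hL
  have h1 : MemLp (fun a => 1 + (|V a| + |D a|)) 2 ν :=
    (memLp_const (1:ℝ)).add (hV.abs.add hD.abs)
  have h2 : MemLp (fun a => |Y a| + |D a|) 2 ν := hY.abs.add hD.abs
  have key := hasDerivAt_integral_of_dominated_loc_of_deriv_le (μ := ν) (𝕜 := ℝ) (x₀ := (0:ℝ))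
    (F := fun e a => L (X a + e * Y a) (V a + e * D a) + W a * (V a + e * D a))
    (F' := fun e a => Lx L (X a + e * Y a) (V a + e * D a) * Y a +
      (Lv L (X a + e * Y a) (V a + e * D a) + W a) * D a)
    (bound := fun a => C * ((1 + (|V a| + |D a|)) * (|Y a| + |D a|)) + |W a| * |D a|)
    (s := Metric.ball 0 1) (Metric.ball_mem_nhds _ one_pos)
    (Filter.Eventually.of_forall fun e =>
      (WEL_integrable ν L hL C hC hb _ _ W (hXe e) (hVe e) hW).1)
    (WEL_integrable ν L hL C hC hb _ _ W (hXe 0) (hVe 0) hW)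
    (by
      have hp := (hXe 0).1.prodMk (hVe 0).1
      exact ((hcx.comp_aestronglyMeasurable hp).mul hY.1).add
        (((hcv.comp_aestronglyMeasurable hp).add hW.1).mul hD.1))
    (Filter.Eventually.of_forall fun a e he => by
      have he' : |e| ≤ 1 := by simpa using (mem_ball_zero_iff.1 he).le
      obtain ⟨b1, b2⟩ := hb (X a + e * Y a) (V a + e * D a)
      have hv : |V a + e * D a| ≤ |V a| + |D a| := by
        refine (abs_add_le _ _).trans ?_
        rw [abs_mul]
        have := mul_le_of_le_one_left (abs_nonneg (D a)) he'
        linarith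
      have h3 : C * (1 + |V a + e * D a|) ≤ C * (1 + (|V a| + |D a|)) := by gcongr
      rw [Real.norm_eq_abs]
      calc _ ≤ _ := abs_add_le _ _
        _ ≤ C * (1 + (|V a| + |D a|)) * |Y a| + (C * (1 + (|V a| + |D a|)) + |W a|) * |D a| := by
            rw [abs_mul, abs_mul]
            gcongr
            · exact b1.trans h3
            · exact (abs_add_le _ _).trans (by linarith)
        _ = _ := by ring)
    (((h1.integrable_mul h2).const_mul C).add (hW.abs.integrable_mul hD.abs))
    (Filter.Eventually.of_forall fun a e _ => by
      have t1 := WEL_deriv L hL (X a) (Y a) (V a) (D a) e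
      have t2 : HasDerivAt (fun z : ℝ => W a * (V a + z * D a)) (W a * D a) e := by
        simpa using (((hasDerivAt_id e).mul_const (D a)).const_add (V a)).const_mul (W a)
      exact (t1.add t2).congr_deriv (by ring))
  simpa using key

section
variable {Ω : Type*} {m : MeasurableSpace Ω} (P : Measure Ω) [IsProbabilityMeasure P]
    (T : ℝ) (𝔽 : Filtration ℝ m)

lemma WEL_sm (v : ℝ → Ω → ℝ) (hv : ProgMeasurable 𝔽 v) :
    StronglyMeasurable (fun p : Ω × ℝ => v (min p.2 T) p.1) := by
  have h := hv T
  have h' : StronglyMeasurable (fun p : Set.Iic T × Ω => v p.1 p.2) :=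
    h.mono (sup_le_sup le_rfl (MeasurableSpace.comap_mono (𝔽.le T)))
  have hg : Measurable (fun p : Ω × ℝ => ((⟨min p.2 T, Set.mem_Iic.2 (min_le_right _ _)⟩ : Set.Iic T), p.1)) := by
    refine Measurable.prodMk ?_ measurable_fst
    exact Measurable.subtype_mk (measurable_snd.min measurable_const)
  exact h'.comp_measurable hg

lemma WEL_ae_snd : ∀ᵐ p ∂(P.prod (volume.restrict (Set.Ioc (0:ℝ) T))), p.2 ∈ Set.Ioc (0:ℝ) T :=
  Measure.quasiMeasurePreserving_snd.ae (ae_restrict_mem measurableSet_Ioc)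

lemma WEL_aesm (v : ℝ → Ω → ℝ) (hv : ProgMeasurable 𝔽 v) :
    AEStronglyMeasurable (fun p : Ω × ℝ => v p.2 p.1)
      (P.prod (volume.restrict (Set.Ioc (0:ℝ) T))) := by
  refine ⟨_, WEL_sm T 𝔽 v hv, ?_⟩
  filter_upwards [WEL_ae_snd P T] with p hp
  rw [min_eq_left hp.2]

lemma WEL_memH_iff (v : ℝ → Ω → ℝ) : MemH P T 𝔽 v ↔ ProgMeasurable 𝔽 v ∧
    MemLp (fun p : Ω × ℝ => v p.2 p.1) 2 (P.prod (volume.restrict (Set.Ioc (0:ℝ) T))) := by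
  unfold MemH
  refine and_congr_right fun hv => ?_
  have hm := WEL_aesm P T 𝔽 v hv
  rw [memLp_two_iff_integrable_sq hm]
  have hm2 : AEStronglyMeasurable (fun p : Ω × ℝ => (v p.2 p.1)^2)
      (P.prod (volume.restrict (Set.Ioc (0:ℝ) T))) := hm.pow 2
  rw [← lintegral_prod (fun p : Ω × ℝ => ENNReal.ofReal ((v p.2 p.1)^2)) hm2.aemeasurable.ennreal_ofReal]
  unfold Integrable
  rw [hasFiniteIntegral_iff_ofReal (Filter.Eventually.of_forall fun p => sq_nonneg _)]
  exact ⟨fun h => ⟨hm2, h⟩, fun h => h.2⟩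

lemma WEL_traj_meas (v : ℝ → Ω → ℝ) (hv : ProgMeasurable 𝔽 v) :
    ∃ Z : Ω × ℝ → ℝ, StronglyMeasurable Z ∧
      ∀ ω, ∀ t ∈ Set.Ioc (0:ℝ) T, traj 0 v t ω = Z (ω, t) := by
  have hs := WEL_sm T 𝔽 v hv
  let S : Set ((Ω × ℝ) × ℝ) := {q | 0 < q.2 ∧ q.2 ≤ q.1.2}
  have hS : MeasurableSet S :=
    (measurableSet_lt measurable_const measurable_snd).inter
      (measurableSet_le measurable_snd (measurable_snd.comp measurable_fst))
  have hg : StronglyMeasurable (S.indicator fun q : (Ω × ℝ) × ℝ => v (min q.2 T) q.1.1) :=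
    (hs.comp_measurable (g := fun q : (Ω × ℝ) × ℝ => (q.1.1, q.2)) (by fun_prop)).indicator hS
  refine ⟨_, hg.integral_prod_right' (ν := volume), fun ω t ht => ?_⟩
  rw [traj, zero_add, intervalIntegral.integral_of_le ht.1.le, ← integral_indicator measurableSet_Ioc]
  congr 1
  funext s
  by_cases h : s ∈ Set.Ioc 0 t
  · have h' : ((ω, t), s) ∈ S := h
    rw [Set.indicator_of_mem h, Set.indicator_of_mem h', min_eq_left (h.2.trans ht.2)]
  · have h' : ((ω, t), s) ∉ S := h
    rw [Set.indicator_of_notMem h, Set.indicator_of_notMem h']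

lemma WEL_cs (hT : 0 < T) (f : ℝ → ℝ) (h1 : IntegrableOn f (Set.Ioc (0:ℝ) T))
    (h2 : IntegrableOn (fun s => f s ^ 2) (Set.Ioc (0:ℝ) T)) (t : ℝ) (ht : t ∈ Set.Ioc (0:ℝ) T) :
    (∫ s in (0:ℝ)..t, f s) ^ 2 ≤ T * ∫ s in Set.Ioc (0:ℝ) T, f s ^ 2 := by
  set A := ∫ s in Set.Ioc (0:ℝ) T, |f s| with hA
  set G := ∫ s in Set.Ioc (0:ℝ) T, f s ^ 2
  have hb : |∫ s in (0:ℝ)..t, f s| ≤ A := by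
    rw [intervalIntegral.integral_of_le ht.1.le]
    refine (abs_integral_le_integral_abs).trans ?_
    exact setIntegral_mono_set h1.abs (Filter.Eventually.of_forall fun _ => abs_nonneg _)
      (Set.Ioc_subset_Ioc_right ht.2).eventuallyLE
  have h0 : 0 ≤ ∫ s in Set.Ioc (0:ℝ) T, (|f s| - A / T) ^ 2 :=
    integral_nonneg fun _ => sq_nonneg _
  have he : ∫ s in Set.Ioc (0:ℝ) T, (|f s| - A / T) ^ 2 = G - 2 * (A / T) * A + (A / T) ^ 2 * T := by
    have : ∀ s, (|f s| - A / T) ^ 2 = f s ^ 2 - 2 * (A / T) * |f s| + (A / T) ^ 2 := by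
      intro s; rw [← sq_abs (f s)]; ring
    simp_rw [this]
    have hs : IntegrableOn (fun s => f s ^ 2 - 2 * (A / T) * |f s|) (Set.Ioc (0:ℝ) T) :=
      Integrable.sub h2 (Integrable.const_mul h1.abs _)
    rw [integral_add hs (integrable_const _),
      integral_sub h2 (h1.abs.const_mul _), integral_const_mul]
    simp [hT.le]; ring
  rw [he] at h0
  have hG : A ^ 2 ≤ T * G := by
    have : G - 2 * (A / T) * A + (A / T) ^ 2 * T = (T * G - A ^ 2) / T := by field_simp; ring
    rw [this] at h0
    have := mul_nonneg h0 hT.le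
    rw [div_mul_cancel₀ _ hT.ne'] at this
    linarith
  calc _ = |∫ s in (0:ℝ)..t, f s| ^ 2 := (sq_abs _).symm
    _ ≤ A ^ 2 := by gcongr
    _ ≤ _ := hG

lemma WEL_ae_int (v : ℝ → Ω → ℝ) (hv : MemH P T 𝔽 v) :
    ∀ᵐ ω ∂P, IntegrableOn (fun s => v s ω) (Set.Ioc (0:ℝ) T) ∧
      IntegrableOn (fun s => v s ω ^ 2) (Set.Ioc (0:ℝ) T) := by
  have h := ((WEL_memH_iff P T 𝔽 v).1 hv).2
  filter_upwards [(h.integrable (by norm_num)).prod_right_ae, h.integrable_sq.prod_right_ae]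
    with ω h1 h2
  exact ⟨h1, h2⟩

lemma WEL_traj_memLp (hT : 0 < T) (x0 : ℝ) (v : ℝ → Ω → ℝ) (hv : MemH P T 𝔽 v) :
    MemLp (fun p : Ω × ℝ => traj x0 v p.2 p.1) 2 (P.prod (volume.restrict (Set.Ioc (0:ℝ) T))) ∧
    MemLp (fun ω => traj x0 v T ω) 2 P := by
  have e0 : ∀ t ω, traj x0 v t ω = x0 + traj 0 v t ω := by intro t ω; simp [traj]
  simp_rw [e0]
  have h := ((WEL_memH_iff P T 𝔽 v).1 hv).2
  obtain ⟨Z, hZ, hZe⟩ := WEL_traj_meas T 𝔽 v hv.1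
  have hG : Integrable (fun ω => T * ∫ s in Set.Ioc (0:ℝ) T, v s ω ^ 2) P :=
    h.integrable_sq.integral_prod_left.const_mul T
  have hae := WEL_ae_int P T 𝔽 v hv
  constructor
  · refine (memLp_const x0).add ?_
    have hm : AEStronglyMeasurable (fun p : Ω × ℝ => traj 0 v p.2 p.1)
        (P.prod (volume.restrict (Set.Ioc (0:ℝ) T))) := by
      refine ⟨Z, hZ, ?_⟩
      filter_upwards [WEL_ae_snd P T] with p hp
      exact hZe _ _ hp
    rw [memLp_two_iff_integrable_sq hm]
    refine (hG.comp_fst (volume.restrict (Set.Ioc (0:ℝ) T))).mono' (hm.pow 2) ?_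
    filter_upwards [WEL_ae_snd P T, Measure.quasiMeasurePreserving_fst.ae hae] with p hp hi
    rw [Real.norm_eq_abs, abs_of_nonneg (sq_nonneg _), traj, zero_add]
    exact WEL_cs T hT _ hi.1 hi.2 _ hp
  · refine (memLp_const x0).add ?_
    have hTm : T ∈ Set.Ioc (0:ℝ) T := ⟨hT, le_rfl⟩
    have hm : AEStronglyMeasurable (fun ω => traj 0 v T ω) P := by
      have : (fun ω => traj 0 v T ω) = fun ω => Z (ω, T) := by
        funext ω; exact hZe _ _ hTm
      rw [this]
      exact (hZ.comp_measurable (g := fun ω => (ω, T)) (by fun_prop)).aestronglyMeasurable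
    rw [memLp_two_iff_integrable_sq hm]
    refine hG.mono' (hm.pow 2) ?_
    filter_upwards [hae] with ω hi
    rw [Real.norm_eq_abs, abs_of_nonneg (sq_nonneg _), traj, zero_add]
    exact WEL_cs T hT _ hi.1 hi.2 _ hTm

lemma WEL_memH_add (v d : ℝ → Ω → ℝ) (hv : MemH P T 𝔽 v) (hd : MemH P T 𝔽 d) (e : ℝ) :
    MemH P T 𝔽 (fun t ω => v t ω + e * d t ω) := by
  have h1 := (WEL_memH_iff P T 𝔽 v).1 hv
  have h2 := (WEL_memH_iff P T 𝔽 d).1 hd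
  rw [WEL_memH_iff]
  exact ⟨fun i => (h1.1 i).add ((h2.1 i).const_mul e), h1.2.add (h2.2.const_mul e)⟩

end

theorem weak_euler_lagrange
    {Ω : Type*} {m : MeasurableSpace Ω} (P : Measure Ω) [IsProbabilityMeasure P]
    (T : ℝ) (hT : 0 < T) (𝔽 : Filtration ℝ m)
    (L : ℝ → ℝ → ℝ) (Ψ : ℝ → ℝ)
    (hL_C1 : ContDiff ℝ 1 (Function.uncurry L))
    (hΨ_C1 : ContDiff ℝ 1 Ψ)
    -- (A3): growth of Ψ and Ψ'
    (hΨ_growth : ∃ C > (0:ℝ), ∀ x, Ψ x ≤ C * (1 + |x| ^ 2))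
    (hΨ'_growth : ∃ C > (0:ℝ), ∀ x, |deriv Ψ x| ≤ C * (1 + |x|))
    -- (A4): growth of L, L_x, L_v
    (hL_growth : ∃ β > (0:ℝ), ∀ x v, L x v ≤ β * (1 + |v| ^ 2))
    (hL_deriv_growth : ∃ C > (0:ℝ), ∀ x v,
      |Lx L x v| ≤ C * (1 + |v|) ∧ |Lv L x v| ≤ C * (1 + |v|))
    (x0 : ℝ) (ϖ : ℝ → Ω → ℝ) (hϖ : MemH P T 𝔽 ϖ)
    (vstar : ℝ → Ω → ℝ) (hvstar : MemH P T 𝔽 vstar)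
    (hmin : ∀ v, MemH P T 𝔽 v → cost P T L Ψ ϖ x0 vstar ≤ cost P T L Ψ ϖ x0 v) :
    ∀ δv, MemH P T 𝔽 δv →
      ∫ ω, ((∫ t in Set.Ioc (0:ℝ) T,
          (Lx L (traj x0 vstar t ω) (vstar t ω) * traj 0 δv t ω +
            (Lv L (traj x0 vstar t ω) (vstar t ω) + ϖ t ω) * δv t ω)) +
        deriv Ψ (traj x0 vstar T ω) * traj 0 δv T ω) ∂P = 0 := by
  intro δv hδ
  obtain ⟨C, hC, hb⟩ := hL_deriv_growth
  obtain ⟨C', hC', hb'⟩ := hΨ'_growth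
  obtain ⟨hX, hXT⟩ := WEL_traj_memLp P T 𝔽 hT x0 vstar hvstar
  obtain ⟨hY, hYT⟩ := WEL_traj_memLp P T 𝔽 hT 0 δv hδ
  have hV := ((WEL_memH_iff P T 𝔽 _).1 hvstar).2
  have hD := ((WEL_memH_iff P T 𝔽 _).1 hδ).2
  have hW := ((WEL_memH_iff P T 𝔽 _).1 hϖ).2
  set ν := P.prod (volume.restrict (Set.Ioc (0:ℝ) T)) with hν
  obtain ⟨i1, d1⟩ := WEL_main ν L hL_C1 C hC hb _ _ _ _ _ hX hY hV hD hW
  have hLΨ : ContDiff ℝ 1 (Function.uncurry (fun _ v : ℝ => Ψ v)) := hΨ_C1.comp contDiff_snd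
  have hbΨ : ∀ x v, |Lx (fun _ v : ℝ => Ψ v) x v| ≤ C' * (1 + |v|) ∧
      |Lv (fun _ v : ℝ => Ψ v) x v| ≤ C' * (1 + |v|) := by
    intro x v
    refine ⟨?_, hb' v⟩
    simp only [Lx, deriv_const, abs_zero]
    positivity
  have hz : MemLp (fun _ : Ω => (0:ℝ)) 2 P := memLp_const 0
  obtain ⟨i2, d2⟩ := WEL_main P (fun _ v : ℝ => Ψ v) hLΨ C' hC' hbΨ _ _ _ _ _ hz hz hXT hYT hz
  simp only [Lx, Lv, deriv_const, zero_mul, zero_add, add_zero, mul_zero] at i2 d2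
  have hcost : ∀ e : ℝ, cost P T L Ψ ϖ x0 (fun t ω => vstar t ω + e * δv t ω) =
      (∫ p, (L (traj x0 vstar p.2 p.1 + e * traj 0 δv p.2 p.1) (vstar p.2 p.1 + e * δv p.2 p.1)
        + ϖ p.2 p.1 * (vstar p.2 p.1 + e * δv p.2 p.1)) ∂ν) +
      ∫ ω, Ψ (traj x0 vstar T ω + e * traj 0 δv T ω) ∂P := by
    intro e
    have j1 := WEL_integrable ν L hL_C1 C hC hb _ _ _ (hX.add (hY.const_mul e))
      (hV.add (hD.const_mul e)) hW
    have j2 := WEL_integrable P (fun _ v : ℝ => Ψ v) hLΨ C' hC' hbΨ _ _ _ hz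
      (hXT.add (hYT.const_mul e)) hz
    simp only [zero_mul, add_zero, Pi.add_apply] at j1 j2
    rw [hν, integral_prod _ j1, ← integral_add j1.integral_prod_left j2, cost]
    refine integral_congr_ae ?_
    filter_upwards [WEL_ae_int P T 𝔽 _ hvstar, WEL_ae_int P T 𝔽 _ hδ] with ω hi1 hi2
    have ht : ∀ t ∈ Set.Ioc (0:ℝ) T, traj x0 (fun t ω => vstar t ω + e * δv t ω) t ω =
        traj x0 vstar t ω + e * traj 0 δv t ω := by
      intro t ht
      have k1 : IntervalIntegrable (fun s => vstar s ω) volume 0 t :=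
        (intervalIntegrable_iff_integrableOn_Ioc_of_le ht.1.le).2
          (hi1.1.mono_set (Set.Ioc_subset_Ioc_right ht.2))
      have k2 : IntervalIntegrable (fun s => δv s ω) volume 0 t :=
        (intervalIntegrable_iff_integrableOn_Ioc_of_le ht.1.le).2
          (hi2.1.mono_set (Set.Ioc_subset_Ioc_right ht.2))
      simp only [traj]
      rw [intervalIntegral.integral_add k1 (k2.const_mul e), intervalIntegral.integral_const_mul]
      ring
    rw [ht T ⟨hT, le_rfl⟩]
    congr 1
    refine setIntegral_congr_fun measurableSet_Ioc fun t hti => ?_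
    simp only [ht t hti]
  have hd := d1.add d2
  have hmin' : IsLocalMin (fun e : ℝ => cost P T L Ψ ϖ x0 (fun t ω => vstar t ω + e * δv t ω)) 0 := by
    refine Filter.Eventually.of_forall fun e => ?_
    simpa using hmin _ (WEL_memH_add P T 𝔽 _ _ hvstar hδ e)
  have hd' := hd.congr_of_eventuallyEq (f₁ := fun e : ℝ =>
    cost P T L Ψ ϖ x0 (fun t ω => vstar t ω + e * δv t ω)) (Filter.Eventually.of_forall hcost)
  have hfin := hmin'.hasDerivAt_eq_zero hd'
  rw [hν, integral_prod _ i1, ← integral_add i1.integral_prod_left i2] at hfin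
  exact hfin
end
end

section
/- Let c > 0, γ ≥ 0, T > 0. Define, for t ∈ [0,T], a₁(t) = cγ / (2(c + γ(T−t))), a₂(t) = 0, a₃(t) = −cγ(T − t − 1 + e^{t−T}) / (c + γ(T−t)), a₄(t) = γ(t−T) / (c + γ(T−t)). Then the denominators are strictly positive on [0,T], the four functions are differentiable on [0,T], satisfy the terminal conditions a₁(T) = γ/2, a₂(T) = 0, a₃(T) = 0, a₄(T) = 0, and solve on [0,T] the ODE system: a₁' = 2a₁²/c, a₂' = 2a₁a₂/c, a₃' = a₃(2a₁ + c)/c − c·a₄ − a₂, a₄' = 2a₁(a₄ + 1)/c. -/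
/- STATEMENT 14: In the case η = 0, the explicit functions
   a₁(t) = cγ/(2(c+γ(T−t))), a₂ = 0, a₃(t) = −cγ(T−t−1+e^{t−T})/(c+γ(T−t)),
   a₄(t) = γ(t−T)/(c+γ(T−t)) have positive denominators on [0,T], are
   differentiable there, satisfy the terminal conditions and solve the Riccati
   subsystem on [0,T]. -/

noncomputable section

theorem lq_riccati_subsystem_eta_zero
    (c γ T : ℝ) (hc : 0 < c) (hγ : 0 ≤ γ) (hT : 0 < T)
    (a₁ a₂ a₃ a₄ : ℝ → ℝ)
    (ha₁ : ∀ t, a₁ t = c * γ / (2 * (c + γ * (T - t))))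
    (ha₂ : ∀ t, a₂ t = 0)
    (ha₃ : ∀ t, a₃ t = -(c * γ * (T - t - 1 + Real.exp (t - T))) / (c + γ * (T - t)))
    (ha₄ : ∀ t, a₄ t = γ * (t - T) / (c + γ * (T - t))) :
    (∀ t ∈ Set.Icc (0:ℝ) T, 0 < c + γ * (T - t)) ∧
      (∀ t ∈ Set.Icc (0:ℝ) T,
        DifferentiableAt ℝ a₁ t ∧ DifferentiableAt ℝ a₂ t ∧
          DifferentiableAt ℝ a₃ t ∧ DifferentiableAt ℝ a₄ t) ∧
      (a₁ T = γ / 2 ∧ a₂ T = 0 ∧ a₃ T = 0 ∧ a₄ T = 0) ∧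
      ∀ t ∈ Set.Icc (0:ℝ) T,
        deriv a₁ t = 2 * (a₁ t) ^ 2 / c ∧
        deriv a₂ t = 2 * a₁ t * a₂ t / c ∧
        deriv a₃ t = a₃ t * (2 * a₁ t + c) / c - c * a₄ t - a₂ t ∧
        deriv a₄ t = 2 * a₁ t * (a₄ t + 1) / c := by
  have hpos : ∀ t ∈ Set.Icc (0:ℝ) T, 0 < c + γ * (T - t) := by
    intro t ht
    have := mul_nonneg hγ (sub_nonneg.2 ht.2)
    linarith
  have e1 : a₁ = fun t => c * γ / (2 * (c + γ * (T - t))) := funext ha₁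
  have e2 : a₂ = fun _ => 0 := funext ha₂
  have e3 : a₃ = fun t => -(c * γ * (T - t - 1 + Real.exp (t - T))) / (c + γ * (T - t)) :=
    funext ha₃
  have e4 : a₄ = fun t => γ * (t - T) / (c + γ * (T - t)) := funext ha₄
  have hs : ∀ t : ℝ, HasDerivAt (fun t : ℝ => T - t) (-1) t := fun t =>
    (hasDerivAt_id t).const_sub T
  have hr : ∀ t : ℝ, HasDerivAt (fun t : ℝ => t - T) 1 t := fun t =>
    (hasDerivAt_id t).sub_const T
  have hD : ∀ t : ℝ, HasDerivAt (fun t : ℝ => c + γ * (T - t)) (γ * (-1)) t := fun t =>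
    ((hs t).const_mul γ).const_add c
  have d1 : ∀ t ∈ Set.Icc (0:ℝ) T, HasDerivAt a₁ (2 * (a₁ t) ^ 2 / c) t := by
    intro t ht
    have hp := (hpos t ht).ne'
    rw [ha₁ t, e1]
    refine ((hasDerivAt_const t (c * γ)).fun_div ((hD t).const_mul 2)
      (mul_ne_zero two_ne_zero hp)).congr_deriv ?_
    generalize c + γ * (T - t) = D at hp
    field_simp
    ring
  have d2 : ∀ t ∈ Set.Icc (0:ℝ) T, HasDerivAt a₂ (2 * a₁ t * a₂ t / c) t := by
    intro t ht
    rw [ha₂ t, e2]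
    exact (hasDerivAt_const t (0:ℝ)).congr_deriv (by simp)
  have d3 : ∀ t ∈ Set.Icc (0:ℝ) T,
      HasDerivAt a₃ (a₃ t * (2 * a₁ t + c) / c - c * a₄ t - a₂ t) t := by
    intro t ht
    have hp := (hpos t ht).ne'
    rw [ha₃ t, ha₁ t, ha₄ t, ha₂ t, e3]
    refine (((((hs t).sub_const 1).fun_add (hr t).exp).const_mul (c * γ)).fun_neg.fun_div (hD t)
      hp).congr_deriv ?_
    generalize c + γ * (T - t) = D at hp
    generalize Real.exp (t - T) = E
    field_simp
    ring
  have d4 : ∀ t ∈ Set.Icc (0:ℝ) T, HasDerivAt a₄ (2 * a₁ t * (a₄ t + 1) / c) t := by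
    intro t ht
    have hp := (hpos t ht).ne'
    rw [ha₄ t, ha₁ t, e4]
    refine (((hr t).const_mul γ).fun_div (hD t) hp).congr_deriv ?_
    generalize c + γ * (T - t) = D at hp
    field_simp
    ring
  refine ⟨hpos, fun t ht => ⟨(d1 t ht).differentiableAt, (d2 t ht).differentiableAt,
    (d3 t ht).differentiableAt, (d4 t ht).differentiableAt⟩, ⟨?_, ha₂ T, ?_, ?_⟩,
    fun t ht => ⟨(d1 t ht).deriv, (d2 t ht).deriv, (d3 t ht).deriv, (d4 t ht).deriv⟩⟩
  · rw [ha₁]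
    have := hc.ne'
    simp only [sub_self, mul_zero, add_zero]
    field_simp
  · rw [ha₃]; simp
  · rw [ha₄]; simp
end
end

section
/- Let σ, c, γ, T ∈ ℝ and define f : ℝ → ℝ by f(t) = −(σ²/2)(e^t − 1) e^{−2t−T} ( c(e^t + 1)e^T − γ e^t (e^t − 2e^T + 1) ). Then f is twice differentiable and f''(t) = (σ²/2) e^{−2t−T} ( 4c e^T + 2γ e^{T+t} + γ e^t (e^{2t} − 1) ) for all t ∈ ℝ. Moreover, if c ≥ 0 and γ ≥ 0, then f''(t) ≥ 0 for all t ≥ 0, so f is convex on [0, ∞). -/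
/- STATEMENT 15: The covariance function
   f(t) = −(σ²/2)(eᵗ−1)e^{−2t−T}( c(eᵗ+1)e^T − γeᵗ(eᵗ−2e^T+1) )
   is twice differentiable with
   f''(t) = (σ²/2)e^{−2t−T}( 4ce^T + 2γe^{T+t} + γeᵗ(e^{2t}−1) );
   if c, γ ≥ 0 then f'' ≥ 0 on [0,∞), hence f is convex on [0,∞). -/

noncomputable section

theorem covariance_second_derivative_and_convexity
    (σ c γ T : ℝ) (f : ℝ → ℝ)
    (hf : ∀ t, f t = -(σ ^ 2 / 2) * (Real.exp t - 1) * Real.exp (-2 * t - T) *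
      (c * (Real.exp t + 1) * Real.exp T -
        γ * Real.exp t * (Real.exp t - 2 * Real.exp T + 1))) :
    (Differentiable ℝ f ∧ Differentiable ℝ (deriv f)) ∧
      (∀ t : ℝ, deriv (deriv f) t = σ ^ 2 / 2 * Real.exp (-2 * t - T) *
        (4 * c * Real.exp T + 2 * γ * Real.exp (T + t) +
          γ * Real.exp t * (Real.exp (2 * t) - 1))) ∧
      (0 ≤ c → 0 ≤ γ →
        (∀ t : ℝ, 0 ≤ t → 0 ≤ deriv (deriv f) t) ∧
          ConvexOn ℝ (Set.Ici (0:ℝ)) f) := by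
  have hE : Real.exp T * Real.exp (-T) = 1 := by rw [← Real.exp_add]; simp
  have hX : ∀ t : ℝ, Real.exp t * Real.exp (-t) = 1 := by
    intro t; rw [← Real.exp_add]; simp
  have hsplit : ∀ t : ℝ, Real.exp (-2 * t - T) = Real.exp (-t) ^ 2 * Real.exp (-T) := by
    intro t; rw [← Real.exp_nat_mul, ← Real.exp_add]; congr 1; push_cast; ring
  have hd : ∀ t : ℝ, HasDerivAt (fun t : ℝ => Real.exp (-t)) (-Real.exp (-t)) t := by
    intro t
    simpa using (hasDerivAt_neg t).exp
  have hf' : f = fun t => -(σ ^ 2 / 2) * (c - c * Real.exp (-t) ^ 2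
      - γ * Real.exp (-T) * Real.exp t + γ * Real.exp (-T) * Real.exp (-t)
      + 2 * γ - 2 * γ * Real.exp (-t)) := by
    funext t
    rw [hf, hsplit]
    have h1 := hX t
    generalize Real.exp t = x at *
    generalize Real.exp (-t) = y at *
    generalize Real.exp T = E at *
    generalize Real.exp (-T) = F at *
    have hy : y ≠ 0 := by rintro rfl; simp at h1
    have hF : F ≠ 0 := by rintro rfl; simp at hE
    obtain rfl : x = y⁻¹ := eq_inv_of_mul_eq_one_left h1
    obtain rfl : E = F⁻¹ := eq_inv_of_mul_eq_one_left hE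
    field_simp
    ring
  have h1 : ∀ t, HasDerivAt f (-(σ ^ 2 / 2) * (2 * c * Real.exp (-t) ^ 2
      - γ * Real.exp (-T) * Real.exp t - γ * Real.exp (-T) * Real.exp (-t)
      + 2 * γ * Real.exp (-t))) t := by
    intro t
    rw [hf']
    have := ((((((hasDerivAt_const t c).sub (((hd t).pow 2).const_mul c)).sub
      ((Real.hasDerivAt_exp t).const_mul (γ * Real.exp (-T)))).add
      ((hd t).const_mul (γ * Real.exp (-T)))).add (hasDerivAt_const t (2 * γ))).sub
      ((hd t).const_mul (2 * γ))).const_mul (-(σ ^ 2 / 2))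
    refine this.congr_deriv ?_
    push_cast
    ring
  have hdf : deriv f = fun t => (-(σ ^ 2 / 2) * (2 * c * Real.exp (-t) ^ 2
      - γ * Real.exp (-T) * Real.exp t - γ * Real.exp (-T) * Real.exp (-t)
      + 2 * γ * Real.exp (-t))) := funext fun t => (h1 t).deriv
  have h2 : ∀ t, HasDerivAt (deriv f) (σ ^ 2 / 2 * Real.exp (-2 * t - T) *
        (4 * c * Real.exp T + 2 * γ * Real.exp (T + t) +
          γ * Real.exp t * (Real.exp (2 * t) - 1))) t := by
    intro t
    rw [hdf]
    have := ((((((hd t).pow 2).const_mul (2 * c)).sub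
      ((Real.hasDerivAt_exp t).const_mul (γ * Real.exp (-T)))).sub
      ((hd t).const_mul (γ * Real.exp (-T)))).add
      ((hd t).const_mul (2 * γ))).const_mul (-(σ ^ 2 / 2))
    refine this.congr_deriv ?_
    have e2 : Real.exp (2 * t) = Real.exp t ^ 2 := by
      rw [← Real.exp_nat_mul]; norm_num
    rw [hsplit, Real.exp_add, e2]
    have hxy := hX t
    clear this h1 hdf hf' hf hd hsplit hX
    generalize Real.exp t = x at *
    generalize Real.exp (-t) = y at *
    generalize Real.exp T = E at *
    generalize Real.exp (-T) = F at *
    have hy : y ≠ 0 := by rintro rfl; simp at hxy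
    have hF : F ≠ 0 := by rintro rfl; simp at hE
    obtain rfl : x = y⁻¹ := eq_inv_of_mul_eq_one_left hxy
    obtain rfl : E = F⁻¹ := eq_inv_of_mul_eq_one_left hE
    push_cast
    field_simp
    ring
  have hD : Differentiable ℝ f := fun t => (h1 t).differentiableAt
  have hD2 : Differentiable ℝ (deriv f) := fun t => (h2 t).differentiableAt
  refine ⟨⟨hD, hD2⟩, fun t => (h2 t).deriv, fun hc hγ => ?_⟩
  have hnn : ∀ t : ℝ, 0 ≤ t → 0 ≤ deriv (deriv f) t := by
    intro t ht
    rw [(h2 t).deriv]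
    have : 0 ≤ Real.exp (2 * t) - 1 := by
      have := Real.one_le_exp (x := 2 * t) (by linarith)
      linarith
    positivity
  refine ⟨hnn, ?_⟩
  refine convexOn_of_deriv2_nonneg (convex_Ici 0) hD.continuous.continuousOn
    hD.differentiableOn hD2.differentiableOn ?_
  intro x hx
  rw [interior_Ici] at hx
  exact hnn x (le_of_lt hx)
end
end

section
/- Let σ ≠ 0, c > 0, γ ≥ 0, T > 0, and define f : ℝ → ℝ by f(t) = −(σ²/2)(e^t − 1) e^{−2t−T} ( c(e^t + 1)e^T − γ e^t (e^t − 2e^T + 1) ). Then f(0) = 0, f(T) < 0, and f(t) < 0 for every t ∈ (0, T]. -/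
/- STATEMENT 16: The covariance function
   f(t) = −(σ²/2)(eᵗ−1)e^{−2t−T}( c(eᵗ+1)e^T − γeᵗ(eᵗ−2e^T+1) )
   satisfies f(0) = 0, f(T) < 0, and f(t) < 0 for all t ∈ (0,T]:
   supply and price are negatively correlated. -/

noncomputable section

theorem covariance_negative_on_Ioc
    (σ c γ T : ℝ) (hσ : σ ≠ 0) (hc : 0 < c) (hγ : 0 ≤ γ) (hT : 0 < T)
    (f : ℝ → ℝ)
    (hf : ∀ t, f t = -(σ ^ 2 / 2) * (Real.exp t - 1) * Real.exp (-2 * t - T) *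
      (c * (Real.exp t + 1) * Real.exp T -
        γ * Real.exp t * (Real.exp t - 2 * Real.exp T + 1))) :
    f 0 = 0 ∧ f T < 0 ∧ ∀ t ∈ Set.Ioc (0:ℝ) T, f t < 0 := by
  have key : ∀ t ∈ Set.Ioc (0:ℝ) T, f t < 0 := by
    rintro t ⟨h0, h1⟩
    rw [hf]
    have e1 : 1 < Real.exp t := Real.one_lt_exp_iff.mpr h0
    have e2 : Real.exp t ≤ Real.exp T := Real.exp_le_exp.mpr h1
    have hs : 0 < σ ^ 2 / 2 := by positivity
    have hA : 0 < Real.exp t - 1 := by linarith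
    have hB : 0 < c * (Real.exp t + 1) * Real.exp T := by positivity
    have hC : 0 ≤ γ * Real.exp t * (2 * Real.exp T - Real.exp t - 1) :=
      mul_nonneg (by positivity) (by linarith)
    have hD : 0 < c * (Real.exp t + 1) * Real.exp T -
        γ * Real.exp t * (Real.exp t - 2 * Real.exp T + 1) := by linarith
    have hE := mul_pos (mul_pos (mul_pos hs hA) (Real.exp_pos (-2 * t - T))) hD
    linarith
  exact ⟨by simp [hf], key T ⟨hT, le_refl T⟩, key⟩
end
end
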